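/- arXiv:2410.04394 — 2 statements merged into one kernel-verified Lean document; each statement's English description precedes it below -/
import Mathlib

section
/- Let d ≥ 6 be an integer, and set α := d^{−10^{11}·ln d}, ε := 0.2 and L := 24/α. Let G be a d-regular simple graph on [n] whose adjacency matrix has eigenvalues λ_n(G) ≤ … ≤ λ_2(G) ≤ λ_1(G) = d and suppose λ(G) := max{|λ_2(G)|, …, |λ_n(G)|} ≤ 2.1·√(d−1). Then G satisfies part (B) of the long-range expansion property: for every nonempty S ⊆ [n] and every positive integer ℓ with α(d−1)^{ℓ−1}|S| ≤ 3n/4, letting T := {e ∈ E_G : |{v ∈ S : dist_G(v,e) ≤ ℓ−1}| ≥ L(d−1−ε)^ℓ}, there exists a vertex v ∈ S with |{e ∈ T : dist_G(v,e) ≤ ℓ−1}| ≤ L(d−1−ε)^ℓ. -/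
open Finset

attribute [local instance] Classical.propDecidable

noncomputable section

/-- Distance (in `ℕ∞`) from a vertex to a finite set of vertices. -/
def vertexSetDist {n : ℕ} (G : SimpleGraph (Fin n)) (v : Fin n) (S : Finset (Fin n)) : ℕ∞ :=
  S.inf fun w => G.edist v w

/-- Distance (in `ℕ∞`) from a vertex to an (unordered) edge. -/
def edgeDist {n : ℕ} (G : SimpleGraph (Fin n)) (v : Fin n) (e : Sym2 (Fin n)) : ℕ∞ :=
  Sym2.lift ⟨fun a b => min (G.edist v a) (G.edist v b), fun _ _ => min_comm _ _⟩ e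

/-- Distance (in `ℕ∞`) from an (unordered) edge to a finite set of vertices. -/
def edgeSetDist {n : ℕ} (G : SimpleGraph (Fin n)) (e : Sym2 (Fin n)) (S : Finset (Fin n)) : ℕ∞ :=
  S.inf fun v => edgeDist G v e

/-- Part (A) of the long-range expansion property. -/
def ExpanA (n d : ℕ) (G : SimpleGraph (Fin n)) (α : ℝ) : Prop :=
  ∀ S : Finset (Fin n), S.Nonempty → ∀ ℓ : ℕ, 1 ≤ ℓ →
    min (3 * (n : ℝ) / 4) (α * ((d : ℝ) - 1) ^ ℓ * S.card) ≤
      ((univ.filter fun v => vertexSetDist G v S ≤ (ℓ : ℕ∞)).card : ℝ)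

/-- Part (B) of the long-range expansion property. -/
def ExpanB (n d : ℕ) (G : SimpleGraph (Fin n)) [DecidableRel G.Adj] (α ε L : ℝ) : Prop :=
  ∀ S : Finset (Fin n), S.Nonempty → ∀ ℓ : ℕ, 1 ≤ ℓ →
    α * ((d : ℝ) - 1) ^ (ℓ - 1) * S.card ≤ 3 * n / 4 →
    ∃ v ∈ S,
      (((G.edgeFinset.filter fun e =>
            L * ((d : ℝ) - 1 - ε) ^ ℓ ≤
              ((S.filter fun u => edgeDist G u e ≤ ((ℓ - 1 : ℕ) : ℕ∞)).card : ℝ)).filter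
          fun e => edgeDist G v e ≤ ((ℓ - 1 : ℕ) : ℕ∞)).card : ℝ) ≤
        L * ((d : ℝ) - 1 - ε) ^ ℓ

/-- The long-range expansion property `Expan(α, ε, L)`. -/
def Expan (n d : ℕ) (G : SimpleGraph (Fin n)) [DecidableRel G.Adj] (α ε L : ℝ) : Prop :=
  ExpanA n d G α ∧ ExpanB n d G α ε L

/-- `N` is a norm on `ℝ^k`. -/
def IsNorm (k : ℕ) (N : (Fin k → ℝ) → ℝ) : Prop :=
  (∀ x, N x = 0 ↔ x = 0) ∧ (∀ (c : ℝ) (x), N (c • x) = |c| * N x) ∧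
    ∀ x y, N (x + y) ≤ N x + N y

/-- The standard basis of `ℝ^k` is `K`-unconditional for `N`. -/
def UncondConst (k : ℕ) (N : (Fin k → ℝ) → ℝ) (K : ℝ) : Prop :=
  ∀ (σ : Fin k → Bool) (a : Fin k → ℝ),
    N (fun j => (if σ j then (1 : ℝ) else -1) * a j) ≤ K * N a

/-- `N` is a `1`-unconditional norm on `ℝ^k`: `‖y‖ = ‖|y|‖`. -/
def OneUnconditional (k : ℕ) (N : (Fin k → ℝ) → ℝ) : Prop :=
  ∀ y, N y = N fun j => |y j|

/-- `N` has cotype `q` with constant `C`. -/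
def HasCotype (k : ℕ) (N : (Fin k → ℝ) → ℝ) (q C : ℝ) : Prop :=
  ∀ (m : ℕ) (x : Fin m → Fin k → ℝ),
    1 / C ^ q * ∑ i, N (x i) ^ q ≤
      1 / 2 ^ m * ∑ σ : Fin m → Bool, N (∑ i, (if σ i then (1 : ℝ) else -1) • x i) ^ q

/-- The collection of vectors `Y` has restricted cotype `q` with constant `C` w.r.t. `N`. -/
def RestrictedCotype (k : ℕ) (N : (Fin k → ℝ) → ℝ) (q C : ℝ) (Y : Set (Fin k → ℝ)) : Prop :=
  ∀ (m : ℕ), 0 < m → ∀ y : Fin m → Fin k → ℝ, Function.Injective y → (∀ i, y i ∈ Y) →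
    1 / C ^ q * ∑ i, N (y i) ^ q ≤
      1 / 2 ^ m * ∑ σ : Fin m → Bool, N (∑ i, (if σ i then (1 : ℝ) else -1) • y i) ^ q

/-- For an edge `e = {a, b}`, the value `N (f a - f b)` (well-defined when `N` is a norm). -/
def edgeNorm {n k : ℕ} (N : (Fin k → ℝ) → ℝ) (f : Fin n → Fin k → ℝ) (e : Sym2 (Fin n)) : ℝ :=
  Sym2.lift ⟨fun a b => min (N (f a - f b)) (N (f b - f a)), fun _ _ => min_comm _ _⟩ e

/-- Coordinate projection `P_J`. -/
def proj {k : ℕ} (J : Finset (Fin k)) (y : Fin k → ℝ) : Fin k → ℝ :=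
  fun j => if j ∈ J then y j else 0

/-- Indicator vector `χ_J ∈ ℝ^k`. -/
def chi {k : ℕ} (J : Finset (Fin k)) : Fin k → ℝ := fun j => if j ∈ J then 1 else 0

/-- The sequence `a_ℓ = (6/π²) ℓ⁻²`. -/
def aseq (ℓ : ℕ) : ℝ := 6 / Real.pi ^ 2 * (1 / (ℓ : ℝ) ^ 2)

/-- The set of edges `E(S, j; ℓ)`: edges within distance `ℓ - 1` of `S` with a jump in the
`j`-th coordinate. -/
def jumpEdges {n k : ℕ} (G : SimpleGraph (Fin n)) [DecidableRel G.Adj]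
    (f : Fin n → Fin k → ℝ) (j : Fin k) (S : Finset (Fin n)) (ℓ : ℕ) :
    Finset (Sym2 (Fin n)) :=
  G.edgeFinset.filter fun e =>
    edgeSetDist G e S ≤ ((ℓ - 1 : ℕ) : ℕ∞) ∧
      Sym2.lift ⟨fun a b => f a j ≠ f b j, fun _ _ => propext ne_comm⟩ e

/-- The scale `ℓ_{v,j}`. -/
def lvj {n k : ℕ} (G : SimpleGraph (Fin n)) [DecidableRel G.Adj]
    (f : Fin n → Fin k → ℝ) (α : ℝ) (d : ℕ) (v : Fin n) (j : Fin k) : ℕ :=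
  sInf {ℓ : ℕ | 1 ≤ ℓ ∧
    α * aseq ℓ / 6 * ((d : ℝ) - 1) ^ (ℓ - 1) ≤ ((jumpEdges G f j {v} ℓ).card : ℝ)}

/-- The set `V_+(j; ℓ)`. -/
def Vplus {n k : ℕ} (G : SimpleGraph (Fin n)) [DecidableRel G.Adj]
    (f : Fin n → Fin k → ℝ) (α : ℝ) (d : ℕ) (j : Fin k) (ℓ : ℕ) : Finset (Fin n) :=
  univ.filter fun v => f v j = 1 ∧ lvj G f α d v j = ℓ

/-- The set `V_-(j; ℓ)`. -/
def Vminus {n k : ℕ} (G : SimpleGraph (Fin n)) [DecidableRel G.Adj]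
    (f : Fin n → Fin k → ℝ) (α : ℝ) (d : ℕ) (j : Fin k) (ℓ : ℕ) : Finset (Fin n) :=
  univ.filter fun v => f v j = -1 ∧ lvj G f α d v j = ℓ

/-- The scale-`ℓ` support `J(v, ℓ)`. -/
def Jset {n k : ℕ} (G : SimpleGraph (Fin n)) [DecidableRel G.Adj]
    (f : Fin n → Fin k → ℝ) (α : ℝ) (d : ℕ) (v : Fin n) (ℓ : ℕ) : Finset (Fin k) :=
  univ.filter fun j => f v j ≠ 0 ∧ lvj G f α d v j = ℓ

/-- The scale-`ℓ` mutual support `J(v, ℓ, e)`, relative to a family `Ẽ(v, j)` of edge sets. -/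
def JsetE {n k : ℕ} (G : SimpleGraph (Fin n)) [DecidableRel G.Adj]
    (f : Fin n → Fin k → ℝ) (α : ℝ) (d : ℕ) (Et : Fin n → Fin k → Finset (Sym2 (Fin n)))
    (v : Fin n) (ℓ : ℕ) (e : Sym2 (Fin n)) : Finset (Fin k) :=
  (Jset G f α d v ℓ).filter fun j => e ∈ Et v j

end
theorem aux_pow {n d : ℕ} (G : SimpleGraph (Fin n)) [DecidableRel G.Adj]
    (hreg : ∀ v, G.degree v = d) (lam : ℝ) (hlam : 0 ≤ lam)
    (hspec : ∀ y : Fin n → ℝ, ∑ i, y i = 0 →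
      Real.sqrt (∑ i, ((G.adjMatrix ℝ).mulVec y i) ^ 2) ≤ lam * Real.sqrt (∑ i, y i ^ 2))
    (y : Fin n → ℝ) (hy : ∑ i, y i = 0) (k : ℕ) :
    ∑ i, ((G.adjMatrix ℝ) ^ k).mulVec y i = 0 ∧
      Real.sqrt (∑ i, (((G.adjMatrix ℝ) ^ k).mulVec y i) ^ 2) ≤
        lam ^ k * Real.sqrt (∑ i, y i ^ 2) := by
  induction k with
  | zero => simp [hy]
  | succ k ih =>
    rw [pow_succ', ← Matrix.mulVec_mulVec]
    set z := ((G.adjMatrix ℝ) ^ k).mulVec y with hz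
    refine ⟨?_, ?_⟩
    · have h1 : ∀ j, ∑ i, G.adjMatrix ℝ i j = d := by
        intro j
        have := hreg j
        simp only [SimpleGraph.adjMatrix_apply]
        rw [Finset.sum_boole, ← this, ← SimpleGraph.card_neighborFinset_eq_degree]
        congr 2
        ext i
        simp [SimpleGraph.adj_comm]
      simp only [Matrix.mulVec, dotProduct]
      rw [Finset.sum_comm]
      simp_rw [← Finset.sum_mul, h1]
      rw [← Finset.mul_sum, ih.1, mul_zero]
    · refine (hspec z ih.1).trans ?_
      calc lam * Real.sqrt (∑ i, z i ^ 2) ≤ lam * (lam ^ k * Real.sqrt (∑ i, y i ^ 2)) := by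
            gcongr; exact ih.2
        _ = _ := by rw [pow_succ]; ring

theorem aux_const {n d : ℕ} (G : SimpleGraph (Fin n)) [DecidableRel G.Adj]
    (hreg : ∀ v, G.degree v = d) (c : ℝ) (k : ℕ) :
    ((G.adjMatrix ℝ) ^ k).mulVec (fun _ => c) = fun _ => (d : ℝ) ^ k * c := by
  induction k generalizing c with
  | zero => simp
  | succ k ih =>
    rw [pow_succ, ← Matrix.mulVec_mulVec]
    have : (G.adjMatrix ℝ).mulVec (fun _ => c) = fun _ => (d : ℝ) * c := by
      ext i
      simp [SimpleGraph.adjMatrix_mulVec_apply, hreg i]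
    rw [this, ih]
    ext; ring

theorem aux_walk {n : ℕ} (G : SimpleGraph (Fin n)) [DecidableRel G.Adj]
    (v w : Fin n) (m : ℕ) (h : G.edist v w ≤ (m : ℕ∞)) :
    (1 : ℝ) ≤ ∑ k ∈ range (m + 1), ((G.adjMatrix ℝ) ^ k) v w := by
  have hne : G.edist v w ≠ ⊤ := ne_top_of_le_ne_top (ENat.natCast_ne_top m) h
  obtain ⟨p, hp⟩ := SimpleGraph.exists_walk_of_edist_ne_top hne
  have hle : p.length ≤ m := by
    rw [← hp] at h; exact_mod_cast h
  have hnn : ∀ k, (0 : ℝ) ≤ ((G.adjMatrix ℝ) ^ k) v w := by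
    intro k
    rw [SimpleGraph.adjMatrix_pow_apply_eq_card_walk]; positivity
  have h1 : (1 : ℝ) ≤ ((G.adjMatrix ℝ) ^ p.length) v w := by
    rw [SimpleGraph.adjMatrix_pow_apply_eq_card_walk]
    have : 0 < Fintype.card {q : G.Walk v w | q.length = p.length} :=
      Fintype.card_pos_iff.mpr ⟨⟨p, rfl⟩⟩
    exact_mod_cast this
  exact h1.trans (Finset.single_le_sum (f := fun k => ((G.adjMatrix ℝ) ^ k) v w)
    (fun k _ => hnn k) (by simp; omega))

theorem aux_geom (x : ℝ) (hx : 2 ≤ x) (m : ℕ) : ∑ k ∈ range m, x ^ k ≤ x ^ m / (x - 1) := by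
  rw [geom_sum_eq (by linarith)]
  have : 0 < x - 1 := by linarith
  gcongr
  linarith

theorem aux_pointwise {n : ℕ} (G : SimpleGraph (Fin n)) [DecidableRel G.Adj]
    (T : Finset (Sym2 (Fin n))) (v : Fin n) (m : ℕ) :
    ((T.filter fun e => edgeDist G v e ≤ (m : ℕ∞)).card : ℝ) ≤
      ∑ k ∈ range (m + 1), ((G.adjMatrix ℝ) ^ k).mulVec
        (fun w => ((T.filter fun e => w ∈ e).card : ℝ)) v := by
  simp only [Matrix.mulVec, dotProduct]
  rw [Finset.sum_comm]
  simp_rw [← Finset.sum_mul]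
  have hnn : ∀ w, (0 : ℝ) ≤ ∑ k ∈ range (m + 1), ((G.adjMatrix ℝ) ^ k) v w := by
    intro w
    refine Finset.sum_nonneg fun k _ => ?_
    rw [SimpleGraph.adjMatrix_pow_apply_eq_card_walk]; positivity
  have hsub : (T.filter fun e => edgeDist G v e ≤ (m : ℕ∞)) ⊆
      (univ.filter fun w => G.edist v w ≤ (m : ℕ∞)).biUnion
        fun w => T.filter fun e => w ∈ e := by
    intro e he
    rw [mem_filter] at he
    obtain ⟨heT, hd⟩ := he
    rw [mem_biUnion]
    induction e using Sym2.ind with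
    | _ a b =>
      simp only [edgeDist, Sym2.lift_mk, min_le_iff] at hd
      rcases hd with hd | hd
      · exact ⟨a, by simpa using hd, by simp [heT]⟩
      · exact ⟨b, by simpa using hd, by simp [heT]⟩
  have hcard := (card_le_card hsub).trans card_biUnion_le
  calc _ ≤ ∑ w ∈ univ.filter (fun w => G.edist v w ≤ (m : ℕ∞)),
          ((T.filter fun e => w ∈ e).card : ℝ) := by exact_mod_cast hcard
    _ ≤ ∑ w ∈ univ.filter (fun w => G.edist v w ≤ (m : ℕ∞)),
          (∑ k ∈ range (m + 1), ((G.adjMatrix ℝ) ^ k) v w) *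
          ((T.filter fun e => w ∈ e).card : ℝ) := by
        refine Finset.sum_le_sum fun w hw => ?_
        have := aux_walk G v w m (by simpa using hw)
        exact le_mul_of_one_le_left (by positivity) this
    _ ≤ _ := by
        refine Finset.sum_le_sum_of_subset_of_nonneg (filter_subset _ _) fun w _ _ => ?_
        exact mul_nonneg (hnn w) (by positivity)

theorem aux_tsum {n : ℕ} (G : SimpleGraph (Fin n)) [DecidableRel G.Adj]
    (T : Finset (Sym2 (Fin n))) :
    ∑ w, ((T.filter fun e => w ∈ e).card : ℝ) ≤ 2 * T.card := by
  have h : ∑ w : Fin n, (T.filter fun e => w ∈ e).card =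
      ∑ e ∈ T, (univ.filter fun w : Fin n => w ∈ e).card :=
    Finset.sum_card_bipartiteAbove_eq_sum_card_bipartiteBelow (fun (w : Fin n) e => w ∈ e)
  have h2 : ∑ e ∈ T, (univ.filter fun w : Fin n => w ∈ e).card ≤ T.card * 2 := by
    refine Finset.sum_le_card_nsmul _ _ _ fun e _ => ?_
    induction e using Sym2.ind with
    | _ a b =>
      refine (card_le_card (t := {a, b}) ?_).trans card_le_two
      intro w; simp
  rw [← h] at h2
  have : ((∑ w : Fin n, (T.filter fun e => w ∈ e).card : ℕ) : ℝ) ≤ ((T.card * 2 : ℕ) : ℝ) := by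
    exact_mod_cast h2
  push_cast at this
  linarith

theorem aux_tle {n d : ℕ} (G : SimpleGraph (Fin n)) [DecidableRel G.Adj]
    (hreg : ∀ v, G.degree v = d)
    (T : Finset (Sym2 (Fin n))) (hT : T ⊆ G.edgeFinset) (w : Fin n) :
    ((T.filter fun e => w ∈ e).card : ℝ) ≤ d := by
  rw [← hreg w, ← SimpleGraph.card_incidenceFinset_eq_degree]
  have : (T.filter fun e => w ∈ e) ⊆ G.incidenceFinset w := by
    intro e he
    rw [mem_filter] at he
    rw [SimpleGraph.mem_incidenceFinset]
    exact ⟨by simpa using hT he.1, he.2⟩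
  exact_mod_cast card_le_card this

/-- The main upper bound on the number of incidences. -/
theorem aux_upper {n d : ℕ} (hn : 0 < n) (hd : 6 ≤ d) (G : SimpleGraph (Fin n))
    [DecidableRel G.Adj]
    (hreg : ∀ v, G.degree v = d) (lam : ℝ) (hlam : 2 ≤ lam)
    (hspec : ∀ y : Fin n → ℝ, ∑ i, y i = 0 →
      Real.sqrt (∑ i, ((G.adjMatrix ℝ).mulVec y i) ^ 2) ≤ lam * Real.sqrt (∑ i, y i ^ 2))
    (T : Finset (Sym2 (Fin n))) (hT : T ⊆ G.edgeFinset) (S : Finset (Fin n)) (m : ℕ) :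
    ∑ v ∈ S, ((T.filter fun e => edgeDist G v e ≤ (m : ℕ∞)).card : ℝ) ≤
      (2 * T.card / n * S.card) * ((d : ℝ) ^ (m + 1) / ((d : ℝ) - 1)) +
        lam ^ (m + 1) * (Real.sqrt S.card * Real.sqrt (2 * d * T.card)) := by
  obtain ⟨a, ha⟩ : ∃ a : ℝ, a = (S.card : ℝ) := ⟨_, rfl⟩
  obtain ⟨b, hb⟩ : ∃ b : ℝ, b = (T.card : ℝ) := ⟨_, rfl⟩
  have ha0 : 0 ≤ a := ha ▸ Nat.cast_nonneg _
  have hb0 : 0 ≤ b := hb ▸ Nat.cast_nonneg _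
  rw [← ha, ← hb]
  obtain ⟨t, ht⟩ : ∃ t : Fin n → ℝ, t = fun w => ((T.filter fun e => w ∈ e).card : ℝ) :=
    ⟨_, rfl⟩
  have htw : ∀ w, t w = ((T.filter fun e => w ∈ e).card : ℝ) := fun w => by rw [ht]
  have hn' : (0 : ℝ) < n := by exact_mod_cast hn
  have hd' : (6 : ℝ) ≤ d := by exact_mod_cast hd
  obtain ⟨μ, hμ⟩ : ∃ μ : ℝ, μ = (∑ w, t w) / n := ⟨_, rfl⟩
  have htsum : ∑ w, t w ≤ 2 * b := by rw [ht, hb]; exact aux_tsum G T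
  have htle : ∀ w, t w ≤ d := fun w => by rw [htw]; exact aux_tle G hreg T hT w
  have ht0 : ∀ w, 0 ≤ t w := fun w => by rw [htw]; exact Nat.cast_nonneg _
  have hμ0 : 0 ≤ μ := hμ ▸ div_nonneg (Finset.sum_nonneg fun w _ => ht0 w) hn'.le
  have hμle : μ ≤ 2 * b / n := by rw [hμ]; gcongr
  have hμn : ∑ w, t w = n * μ := by rw [hμ]; field_simp
  obtain ⟨y, hy⟩ : ∃ y : Fin n → ℝ, y = fun w => t w - μ := ⟨_, rfl⟩
  have hysum : ∑ w, y w = 0 := by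
    simp only [hy, Finset.sum_sub_distrib, hμn]; simp
  have hysq : ∑ w, y w ^ 2 ≤ 2 * d * b := by
    have e1 : ∑ w, y w ^ 2 = ∑ w, t w ^ 2 - n * μ ^ 2 := by
      have : ∀ w, y w ^ 2 = t w ^ 2 - 2 * μ * t w + μ ^ 2 := fun w => by simp only [hy]; ring
      simp_rw [this]
      rw [Finset.sum_add_distrib, Finset.sum_sub_distrib, ← Finset.mul_sum, hμn]
      simp; ring
    have e2 : ∑ w, t w ^ 2 ≤ d * ∑ w, t w := by
      rw [Finset.mul_sum]
      refine Finset.sum_le_sum fun w _ => ?_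
      rw [sq]
      exact mul_le_mul_of_nonneg_right (htle w) (ht0 w)
    have e3 : (d : ℝ) * ∑ w, t w ≤ d * (2 * b) := by gcongr
    have : 0 ≤ n * μ ^ 2 := by positivity
    linarith
  have hdec : t = (fun _ => μ) + y := by ext w; simp [hy]
  have hk : ∀ k, ∑ v ∈ S, ((G.adjMatrix ℝ) ^ k).mulVec t v ≤
      (2 * b / n * a) * (d : ℝ) ^ k +
        lam ^ k * (Real.sqrt a * Real.sqrt (2 * d * b)) := by
    intro k
    rw [hdec, Matrix.mulVec_add, aux_const G hreg]
    simp only [Pi.add_apply, Finset.sum_add_distrib, Finset.sum_const, nsmul_eq_mul, ← ha]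
    have hp := (aux_pow G hreg lam (by linarith) hspec y hysum k).2
    set z := ((G.adjMatrix ℝ) ^ k).mulVec y
    have cs : ∑ v ∈ S, z v ≤ Real.sqrt a * Real.sqrt (∑ v, z v ^ 2) := by
      rw [← Real.sqrt_mul ha0]
      refine Real.le_sqrt_of_sq_le ?_
      refine (sq_sum_le_card_mul_sum_sq).trans ?_
      rw [← ha]
      exact mul_le_mul_of_nonneg_left (Finset.sum_le_sum_of_subset_of_nonneg (subset_univ S)
        fun v _ _ => sq_nonneg _) ha0
    have c2 : Real.sqrt (∑ v, z v ^ 2) ≤ lam ^ k * Real.sqrt (2 * d * b) :=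
      hp.trans (by gcongr)
    refine add_le_add ?_ ?_
    · calc a * ((d : ℝ) ^ k * μ) = μ * a * (d : ℝ) ^ k := by ring
        _ ≤ _ := by gcongr
    · calc _ ≤ _ := cs
        _ ≤ Real.sqrt a * (lam ^ k * Real.sqrt (2 * d * b)) := by gcongr
        _ = _ := by ring
  calc _ ≤ ∑ v ∈ S, ∑ k ∈ range (m + 1), ((G.adjMatrix ℝ) ^ k).mulVec t v :=
        Finset.sum_le_sum fun v _ => by rw [ht]; exact aux_pointwise G T v m
    _ = ∑ k ∈ range (m + 1), ∑ v ∈ S, ((G.adjMatrix ℝ) ^ k).mulVec t v := Finset.sum_comm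
    _ ≤ ∑ k ∈ range (m + 1), ((2 * b / n * a) * (d : ℝ) ^ k +
        lam ^ k * (Real.sqrt a * Real.sqrt (2 * d * b))) :=
        Finset.sum_le_sum fun k _ => hk k
    _ = (2 * b / n * a) * ∑ k ∈ range (m + 1), (d : ℝ) ^ k +
        (∑ k ∈ range (m + 1), lam ^ k) * (Real.sqrt a * Real.sqrt (2 * d * b)) := by
        rw [Finset.sum_add_distrib, ← Finset.mul_sum, ← Finset.sum_mul]
    _ ≤ _ := by
        have g1 := aux_geom d (by linarith) (m + 1)
        have g2 : ∑ k ∈ range (m + 1), lam ^ k ≤ lam ^ (m + 1) :=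
          (aux_geom lam hlam (m + 1)).trans (div_le_self (by positivity) (by linarith))
        gcongr

theorem aux_main {n d : ℕ} (hd : 6 ≤ d)
    (G : SimpleGraph (Fin n)) [DecidableRel G.Adj]
    (hreg : ∀ v, G.degree v = d)
    (hspec : ∀ y : Fin n → ℝ, ∑ i, y i = 0 →
      Real.sqrt (∑ i, ((G.adjMatrix ℝ).mulVec y i) ^ 2) ≤
        2.1 * Real.sqrt ((d : ℝ) - 1) * Real.sqrt (∑ i, y i ^ 2))
    (α : ℝ) (hα : 0 < α) (hαd : α * d ≤ 1) :
    ExpanB n d G α 0.2 (24 / α) := by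
  intro S hS ℓ hℓ hcond
  obtain ⟨m, rfl⟩ : ∃ m, ℓ = m + 1 := ⟨ℓ - 1, by omega⟩
  simp only [Nat.add_sub_cancel] at hcond ⊢
  by_contra hcon
  push Not at hcon
  have hn : 0 < n := by
    obtain ⟨v, _⟩ := hS
    exact v.pos
  have hn' : (0 : ℝ) < n := by exact_mod_cast hn
  have hd' : (6 : ℝ) ≤ d := by exact_mod_cast hd
  set K : ℝ := 24 / α * ((d : ℝ) - 1 - 0.2) ^ (m + 1) with hK
  set T := G.edgeFinset.filter fun e => K ≤
    ((S.filter fun u => edgeDist G u e ≤ (m : ℕ∞)).card : ℝ) with hTdef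
  set lam : ℝ := 2.1 * Real.sqrt ((d : ℝ) - 1) with hlamdef
  set q : ℝ := (d : ℝ) - 1 with hq
  have hq5 : 5 ≤ q := by linarith
  have hsq : Real.sqrt q ^ 2 = q := Real.sq_sqrt (by linarith)
  have hsq0 := Real.sqrt_nonneg q
  have hs2 : 2.236 ≤ Real.sqrt q := Real.le_sqrt_of_sq_le (by norm_num; linarith)
  have hlam2 : 2 ≤ lam := by rw [hlamdef]; linarith
  have hlamle : lam ≤ q - 0.2 := by rw [hlamdef]; nlinarith
  have hup := aux_upper hn hd G hreg lam hlam2 hspec T (filter_subset _ _) S m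
  set E : ℝ := ∑ v ∈ S, ((T.filter fun e => edgeDist G v e ≤ (m : ℕ∞)).card : ℝ) with hE
  have hES : K * S.card < E := by
    have : ∑ v ∈ S, K < E := Finset.sum_lt_sum_of_nonempty hS hcon
    simpa [mul_comm] using this
  have hET : K * T.card ≤ E := by
    have h1 : E = ∑ e ∈ T, ((S.filter fun u => edgeDist G u e ≤ (m : ℕ∞)).card : ℝ) := by
      rw [hE]
      exact_mod_cast Finset.sum_card_bipartiteAbove_eq_sum_card_bipartiteBelow
        (s := S) (t := T) (fun v e => edgeDist G v e ≤ (m : ℕ∞))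
    rw [h1]
    have : ∑ e ∈ T, K ≤ ∑ e ∈ T, ((S.filter fun u => edgeDist G u e ≤ (m : ℕ∞)).card : ℝ) :=
      Finset.sum_le_sum fun e he => (mem_filter.mp he).2
    simpa [mul_comm] using this
  have hq0 : 0 < q - 0.2 := by linarith
  have hK0 : 0 < K := by positivity
  -- first term
  have hmain : (2 * (T.card : ℝ) / n * S.card) * ((d : ℝ) ^ (m + 1) / q) ≤ K / 2 * T.card := by
    have hSn : (S.card : ℝ) / n ≤ 3 / (4 * (α * q ^ m)) := by
      rw [div_le_div_iff₀ hn' (by positivity)]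
      linarith
    have hdq : (d : ℝ) ^ (m + 1) ≤ q ^ (m + 1) * (q - 0.2) ^ (m + 1) := by
      rw [← mul_pow]
      refine pow_le_pow_left₀ (by linarith) ?_ _
      nlinarith
    calc (2 * (T.card : ℝ) / n * S.card) * ((d : ℝ) ^ (m + 1) / q)
        = 2 * T.card * (S.card / n) * ((d : ℝ) ^ (m + 1) / q) := by ring
      _ ≤ 2 * T.card * (3 / (4 * (α * q ^ m))) * (q ^ (m + 1) * (q - 0.2) ^ (m + 1) / q) := by
          gcongr
      _ = (3 / 2) / α * (q - 0.2) ^ (m + 1) * T.card := by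
          rw [pow_succ q m]; field_simp; ring
      _ ≤ 12 / α * (q - 0.2) ^ (m + 1) * T.card := by
          gcongr; norm_num
      _ = _ := by rw [hK]; ring
  have herr : lam ^ (m + 1) * (Real.sqrt S.card * Real.sqrt (2 * d * T.card)) ≤
      K / 2 * (Real.sqrt S.card * Real.sqrt T.card) := by
    rw [Real.sqrt_mul (by positivity)]
    have h1 : Real.sqrt (2 * d) ≤ 12 / α := by
      have : (d : ℝ) ≤ 1 / α := by rw [le_div_iff₀ hα]; linarith
      have h12 : (12 : ℝ) / α = 12 * (1 / α) := by ring
      refine Real.sqrt_le_iff.mpr ⟨by positivity, ?_⟩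
      rw [h12]
      nlinarith
    calc lam ^ (m + 1) * (Real.sqrt S.card * (Real.sqrt (2 * d) * Real.sqrt T.card))
        ≤ (q - 0.2) ^ (m + 1) * (Real.sqrt S.card * (12 / α * Real.sqrt T.card)) := by
          gcongr
      _ = _ := by rw [hK]; ring
  have hs := Real.sq_sqrt (Nat.cast_nonneg (α := ℝ) S.card)
  have hu := Real.sq_sqrt (Nat.cast_nonneg (α := ℝ) T.card)
  set s := Real.sqrt (S.card : ℝ)
  set u := Real.sqrt (T.card : ℝ)
  rw [← hs] at hES
  have hsum : E ≤ K / 2 * u ^ 2 + K / 2 * (s * u) := by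
    rw [hu]; exact hup.trans (add_le_add hmain herr)
  rw [← hu] at hET
  nlinarith [mul_nonneg hK0.le (sq_nonneg (s - u))]

/-- Proposition 1.6(b): a `d`-regular graph with `λ(G) ≤ 2.1√(d-1)` satisfies part (B) of the
long-range expansion property with `α = d^{-10^11 ln d}`, `ε = 0.2`, `L = 24/α`. -/
theorem stmt_2 {n d : ℕ} (hd : 6 ≤ d)
    (G : SimpleGraph (Fin n)) [DecidableRel G.Adj]
    (hreg : ∀ v, G.degree v = d)
    (hspec : ∀ y : Fin n → ℝ, ∑ i, y i = 0 →
      Real.sqrt (∑ i, ((G.adjMatrix ℝ).mulVec y i) ^ 2) ≤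
        2.1 * Real.sqrt ((d : ℝ) - 1) * Real.sqrt (∑ i, y i ^ 2)) :
    ExpanB n d G ((d : ℝ) ^ (-(10 ^ 11 * Real.log d))) 0.2
      (24 / (d : ℝ) ^ (-(10 ^ 11 * Real.log d))) := by
  have hd' : (6 : ℝ) ≤ d := by exact_mod_cast hd
  have hlog : 1 ≤ Real.log d := by
    rw [Real.le_log_iff_exp_le (by linarith)]
    linarith [Real.exp_one_lt_d9]
  refine aux_main hd G hreg hspec _ (Real.rpow_pos_of_pos (by linarith) _) ?_
  have h : (d : ℝ) ^ (-(10 ^ 11 * Real.log d)) ≤ (d : ℝ) ^ (-1 : ℝ) := by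
    refine Real.rpow_le_rpow_of_exponent_le (by linarith) ?_
    linarith
  rw [Real.rpow_neg_one] at h
  calc _ ≤ (d : ℝ)⁻¹ * d := by gcongr
    _ = 1 := inv_mul_cancel₀ (by linarith)
end

section
/- Let q ≥ 2, C ≥ 1, K ≥ 1, let d ≥ 3 be an integer, let α, ε ∈ (0,1], let L ≥ 1, and set Γ := 2^115 · q^10 · C^2 · K^3 · d^25 · L^8 / (α^14 · ε^18). Let G be a d-regular simple graph on [n] that satisfies the long-range expansion property Expan(α,ε,L), let ‖·‖_X be a norm on ℝ^k for which the standard basis is K-unconditional and which has cotype q with constant C, and let f : [n] → ℝ^k be a map such that dist_G(v,w) ≤ ‖f(v)−f(w)‖_X ≤ 20·dist_G(v,w) for all v,w ∈ [n]. Then (1/n²)·∑_{v,w∈[n]} dist_G(v,w) ≤ 20·Γ. -/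
open Finset

attribute [local instance] Classical.propDecidable

namespace SG

structure LatNorm (k : ℕ) (q : ℝ) (P : (Fin k → ℝ) → ℝ) : Prop where
  add : ∀ x y, P (x + y) ≤ P x + P y
  smul : ∀ (c : ℝ) x, P (c • x) = |c| * P x
  mono : ∀ x y, (∀ j, |y j| ≤ |x j|) → P y ≤ P x
  pos : ∀ x, P x = 0 → x = 0
  split : ∀ (B : Fin k → Prop) [DecidablePred B] x,
    P (fun j => if B j then x j else 0) ^ q + P (fun j => if B j then 0 else x j) ^ q ≤ P x ^ q

namespace LatNorm
variable {k : ℕ} {q : ℝ} {P : (Fin k → ℝ) → ℝ}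

lemma zero (h : LatNorm k q P) : P 0 = 0 := by
  have := h.smul 0 0
  simpa using this

lemma nonneg (h : LatNorm k q P) (x) : 0 ≤ P x := by
  rw [← h.zero]; apply h.mono; intro j; simp

lemma sum_le (h : LatNorm k q P) {ι : Type*} (s : Finset ι) (x : ι → Fin k → ℝ) :
    P (∑ i ∈ s, x i) ≤ ∑ i ∈ s, P (x i) := by
  classical
  induction s using Finset.induction_on with
  | empty => simp [h.zero]
  | insert a s ha ih =>
    rw [sum_insert ha, sum_insert ha]
    exact (h.add _ _).trans (by gcongr)

lemma smul_of_nonneg (h : LatNorm k q P) {c : ℝ} (hc : 0 ≤ c) (x) : P (c • x) = c * P x := by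
  rw [h.smul, abs_of_nonneg hc]

/-- dual ball -/
def Dual (P : (Fin k → ℝ) → ℝ) (φ : Fin k → ℝ) : Prop :=
  (∀ j, 0 ≤ φ j) ∧ ∀ x, (∀ j, 0 ≤ x j) → ∑ j, φ j * x j ≤ P x

lemma exists_norming (h : LatNorm k q P) (x : Fin k → ℝ) (hx : ∀ j, 0 ≤ x j) :
    ∃ φ, Dual P φ ∧ ∑ j, φ j * x j = P x := by
  have hmain : ∃ g : (Fin k → ℝ) →ₗ[ℝ] ℝ, g x = P x ∧ ∀ y, g y ≤ P y := by
    by_cases hx0 : x = 0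
    · exact ⟨0, by simp [hx0, h.zero], fun y => by simpa using h.nonneg y⟩
    obtain ⟨g, hg1, hg2⟩ := exists_extension_of_le_sublinear
      (LinearPMap.mkSpanSingleton x (P x) hx0) P
      (fun c hc y => h.smul_of_nonneg hc.le y) h.add (by
        rintro ⟨y, hy⟩
        obtain ⟨c, rfl⟩ := Submodule.mem_span_singleton.1 hy
        have e : (LinearPMap.mkSpanSingleton x (P x) hx0) ⟨c • x, hy⟩ = c • P x :=
          LinearPMap.mkSpanSingleton'_apply _ _ _ _ _
        refine (le_of_eq e).trans ?_
        change c • P x ≤ P (c • x)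
        rw [h.smul, smul_eq_mul]
        exact mul_le_mul_of_nonneg_right (le_abs_self c) (h.nonneg x))
    refine ⟨g, ?_, hg2⟩
    have := hg1 ⟨x, Submodule.mem_span_singleton_self x⟩
    rw [LinearPMap.mkSpanSingleton_apply] at this
    exact this
  obtain ⟨g, hgx, hg⟩ := hmain
  have hexp : ∀ y, g y = ∑ j, g (Pi.single j 1) * y j := by
    intro y
    conv_lhs => rw [← Finset.univ_sum_single y]
    rw [map_sum]
    apply sum_congr rfl; intro j _
    have : (Pi.single j (y j) : Fin k → ℝ) = y j • Pi.single j 1 := by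
      ext i; by_cases hi : i = j
      · subst hi; simp
      · simp [hi]
    rw [this, map_smul, smul_eq_mul, mul_comm]
  have hd : ∀ y, (∀ j, 0 ≤ y j) → ∑ j, |g (Pi.single j 1)| * y j ≤ P y := by
    intro y hy
    let z : Fin k → ℝ := fun j => if 0 ≤ g (Pi.single j 1) then y j else - y j
    have h1 : g z = ∑ j, |g (Pi.single j 1)| * y j := by
      rw [hexp]; apply sum_congr rfl; intro j _
      simp only [z]; split_ifs with hj
      · rw [abs_of_nonneg hj]
      · rw [abs_of_neg (not_le.1 hj)]; ring
    rw [← h1]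
    refine (hg z).trans (h.mono _ _ fun j => ?_)
    simp only [z]; split_ifs <;> simp
  refine ⟨fun j => |g (Pi.single j 1)|, ⟨fun j => abs_nonneg _, hd⟩, le_antisymm (hd x hx) ?_⟩
  rw [← hgx, hexp]
  apply sum_le_sum; intro j _
  exact mul_le_mul_of_nonneg_right (le_abs_self _) (hx j)

lemma ind_le (h : LatNorm k q P) (hq : 2 ≤ q) (x : Fin k → ℝ) (hx : ∀ j, 0 ≤ x j) (hPx : P x = 1)
    (φ : Fin k → ℝ) (hφ : Dual P φ) (hφx : ∑ j, φ j * x j = P x) (B : Fin k → Prop)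
    [DecidablePred B] :
    P (fun j => if B j then x j else 0) ^ q ≤ q * ∑ j, if B j then φ j * x j else 0 := by
  set μ := ∑ j, if B j then φ j * x j else 0
  have h1 := h.split B x
  have h2 := hφ.2 (fun j => if B j then 0 else x j) (by intro j; split_ifs; exacts [le_rfl, hx j])
  have h3 : ∑ j, φ j * (if B j then 0 else x j) = 1 - μ := by
    rw [← hPx, ← hφx, ← sum_sub_distrib]
    apply sum_congr rfl; intro j _; split_ifs <;> simp
  rw [h3] at h2
  have hμ : μ ≤ 1 := by
    rw [← hPx, ← hφx]; apply sum_le_sum; intro j _; split_ifs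
    · exact le_rfl
    · exact mul_nonneg (hφ.1 j) (hx j)
  have h4 : (1 - μ) ^ q ≤ P (fun j => if B j then 0 else x j) ^ q :=
    Real.rpow_le_rpow (by linarith) h2 (by linarith)
  have h5 := one_add_mul_self_le_rpow_one_add (s := -μ) (by linarith) (p := q) (by linarith)
  rw [← sub_eq_add_neg] at h5
  rw [hPx, Real.one_rpow] at h1
  linarith

lemma layer (z : ℝ) (n : ℕ) :
    min z (2 ^ n) ≤ 1 + ∑ l ∈ range n, (2:ℝ) ^ l * (if (2:ℝ) ^ l ≤ z then 1 else 0) := by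
  induction n with
  | zero => simp
  | succ n ih =>
    rw [sum_range_succ]
    split_ifs with h
    · rw [min_eq_right h] at ih
      have := min_le_right z ((2:ℝ)^(n+1))
      rw [pow_succ] at this ⊢
      linarith
    · rw [min_eq_left (by linarith)] at ih
      have := min_le_left z ((2:ℝ)^(n+1))
      linarith

lemma mul_le_one (h : LatNorm k q P) (hq : 2 ≤ q) (x : Fin k → ℝ) (hx : ∀ j, 0 ≤ x j)
    (hPx : P x = 1)
    (φ : Fin k → ℝ) (hφ : Dual P φ) (hφx : ∑ j, φ j * x j = P x) (z : Fin k → ℝ)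
    (hz : ∀ j, 0 ≤ z j) :
    P (fun j => z j * x j) ≤ 5 + 4 * ∑ j, φ j * x j * z j ^ (2 * q) := by
  set R := ∑ j, φ j * x j * z j ^ (2 * q)
  have hR : 0 ≤ R := sum_nonneg fun j _ =>
    mul_nonneg (mul_nonneg (hφ.1 j) (hx j)) (Real.rpow_nonneg (hz j) _)
  obtain ⟨n, hn⟩ : ∃ n : ℕ, ∀ j, z j ≤ 2 ^ n := by
    obtain ⟨n, hn⟩ := pow_unbounded_of_one_lt (∑ j, z j) (by norm_num : (1:ℝ) < 2)
    exact ⟨n, fun j => (single_le_sum (f := z) (fun i _ => hz i) (mem_univ j)).trans hn.le⟩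
  have hl : ∀ l : ℕ, P (fun j => if (2:ℝ) ^ l ≤ z j then x j else 0) ≤
      2 * (1 + R) * ((1/2:ℝ) ^ l * (1/2:ℝ)^l) := by
    intro l
    have h1 := h.ind_le hq x hx hPx φ hφ hφx (fun j => (2:ℝ) ^ l ≤ z j)
    have h2 : (∑ j, if (2:ℝ) ^ l ≤ z j then φ j * x j else 0) ≤ ((1/2:ℝ) ^ l * (1/2)^l) ^ q * R := by
      rw [mul_sum]; apply sum_le_sum; intro j _
      have h0 : 0 ≤ φ j * x j := mul_nonneg (hφ.1 j) (hx j)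
      split_ifs with hj
      · have h3 : (1:ℝ) ≤ ((1/2:ℝ) ^ l * (1/2)^l) ^ q * z j ^ (2 * q) := by
          rw [Real.rpow_mul (hz j), ← Real.mul_rpow (by positivity) (Real.rpow_nonneg (hz j) _)]
          apply Real.one_le_rpow _ (by linarith)
          have h4 : (1:ℝ) ≤ (1/2)^l * z j := by
            rw [one_div, inv_pow, ← div_eq_inv_mul, le_div_iff₀ (by positivity)]; linarith
          rw [Real.rpow_two]
          nlinarith
        calc φ j * x j = φ j * x j * 1 := by ring
          _ ≤ φ j * x j * (((1/2:ℝ) ^ l * (1/2)^l) ^ q * z j ^ (2 * q)) := by gcongr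
          _ = _ := by ring
      · have := Real.rpow_nonneg (hz j) (2*q)
        positivity
    have h3 : P (fun j => if (2:ℝ) ^ l ≤ z j then x j else 0) ^ q ≤
        (2 * (1 + R) * ((1/2:ℝ) ^ l * (1/2:ℝ)^l)) ^ q := by
      refine h1.trans ?_
      rw [Real.mul_rpow (by positivity) (by positivity), Real.mul_rpow (by positivity) (by positivity)]
      have hq2 : q ≤ 2 ^ q := by
        have := one_add_mul_self_le_rpow_one_add (s := 1) (by norm_num) (p := q) (by linarith)
        norm_num at this; linarith
      have hR2 : R ≤ (1 + R) ^ q := by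
        have := one_add_mul_self_le_rpow_one_add (s := R) (by linarith) (p := q) (by linarith)
        nlinarith
      calc _ ≤ q * (((1/2:ℝ) ^ l * (1/2)^l) ^ q * R) := by gcongr
        _ ≤ 2 ^ q * (((1/2:ℝ) ^ l * (1/2)^l) ^ q * (1 + R) ^ q) := by gcongr
        _ = _ := by ring
    exact (Real.rpow_le_rpow_iff (h.nonneg _) (by positivity) (by linarith)).1 h3
  have hdec : P (fun j => z j * x j) ≤
      P (x + ∑ l ∈ range n, (2:ℝ) ^ l • (fun j => if (2:ℝ) ^ l ≤ z j then x j else 0)) := by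
    apply h.mono; intro j
    have h1 := layer (z j) n
    rw [min_eq_left (hn j)] at h1
    have h2 := mul_le_mul_of_nonneg_right h1 (hx j)
    rw [abs_of_nonneg (mul_nonneg (hz j) (hx j))]
    refine le_trans (h2.trans (le_of_eq ?_)) (le_abs_self _)
    simp only [Pi.add_apply, Finset.sum_apply, Pi.smul_apply, smul_eq_mul]
    rw [add_mul, one_mul, sum_mul]
    congr 1
    apply sum_congr rfl; intro l _
    split_ifs <;> simp
  have hgeo : ∑ l ∈ range n, (1/2:ℝ)^l ≤ 2 := by
    rw [geom_sum_eq (by norm_num)]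
    have : (0:ℝ) ≤ (1/2)^n := by positivity
    rw [div_le_iff_of_neg (by norm_num)]
    linarith
  calc _ ≤ _ := hdec
    _ ≤ P x + ∑ l ∈ range n, P ((2:ℝ) ^ l • (fun j => if (2:ℝ) ^ l ≤ z j then x j else 0)) :=
        (h.add _ _).trans (add_le_add le_rfl (h.sum_le _ _))
    _ ≤ 1 + ∑ l ∈ range n, 2 * (1 + R) * (1/2:ℝ)^l := by
        rw [hPx]; gcongr with l _
        rw [h.smul_of_nonneg (by positivity)]
        calc _ ≤ (2:ℝ)^l * (2 * (1 + R) * ((1/2:ℝ) ^ l * (1/2:ℝ)^l)) := by gcongr; exact hl l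
          _ = 2 * (1 + R) * (1/2:ℝ)^l * ((2:ℝ)^l * (1/2:ℝ)^l) := by ring
          _ = _ := by rw [← mul_pow]; norm_num
    _ = 1 + 2 * (1 + R) * ∑ l ∈ range n, (1/2:ℝ)^l := by rw [mul_sum]
    _ ≤ 1 + 2 * (1 + R) * 2 := by gcongr
    _ = _ := by ring

lemma psi_le (h : LatNorm k q P) (hq : 2 ≤ q) {V : Type*} [Fintype V] (a : V → ℝ)
    (ha : ∀ i, 0 ≤ a i) (ha1 : ∑ i, a i = 1) (φ : V → Fin k → ℝ) (hφ : ∀ i, Dual P (φ i))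
    (s p : ℝ) (hs : s = 1 - 1 / (2 * q)) (hp : p = 1 / s) (x : Fin k → ℝ) (hx : ∀ j, 0 ≤ x j) :
    ∑ j, (∑ i, a i * φ i j ^ p) ^ s * x j ≤ 9 * P x := by
  have hsp : 0 < s := by
    rw [hs, sub_pos, div_lt_one (by linarith)]; linarith
  have hs1 : s < 1 := by rw [hs]; have : 0 < 1 / (2 * q) := by positivity
                         linarith
  have hp1 : 1 < p := by rw [hp]; exact (one_lt_div hsp).2 hs1
  have hps : p * s = 1 := by rw [hp]; field_simp
  have hr : (p - 1) * (2 * q) = p := by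
    have : 1 / (2 * q) = 1 - s := by linarith
    have h2 : (1 - s) * (2 * q) = 1 := by rw [← this]; field_simp
    have : p - 1 = p * (1 - s) := by rw [mul_sub, hps, mul_one]
    rw [this, mul_assoc, h2, mul_one]
  -- reduce to P x = 1
  wlog hPx : P x = 1 generalizing x
  · by_cases h0 : P x = 0
    · have := h.pos x h0
      subst this
      simp [h0]
    · have hpos : 0 < P x := lt_of_le_of_ne (h.nonneg x) (Ne.symm h0)
      have := this ((P x)⁻¹ • x) (fun j => by
        simp only [Pi.smul_apply, smul_eq_mul]; exact mul_nonneg (inv_nonneg.2 hpos.le) (hx j)) (by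
        rw [h.smul_of_nonneg (inv_nonneg.2 hpos.le)]; field_simp)
      rw [h.smul_of_nonneg (inv_nonneg.2 hpos.le), inv_mul_cancel₀ h0] at this
      have e : ∑ j, (∑ i, a i * φ i j ^ p) ^ s * ((P x)⁻¹ • x) j =
          (P x)⁻¹ * ∑ j, (∑ i, a i * φ i j ^ p) ^ s * x j := by
        rw [mul_sum]; apply sum_congr rfl; intro j _
        simp only [Pi.smul_apply, smul_eq_mul]; ring
      rw [e, ← div_eq_inv_mul, div_le_iff₀ hpos] at this
      linarith
  obtain ⟨ξ, hξ, hξx⟩ := h.exists_norming x hx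
  set ψ : Fin k → ℝ := fun j => (∑ i, a i * φ i j ^ p) ^ s with hψ
  have hS0 : ∀ j, 0 ≤ ∑ i, a i * φ i j ^ p := fun j =>
    sum_nonneg fun i _ => mul_nonneg (ha i) (Real.rpow_nonneg ((hφ i).1 j) _)
  have hψ0 : ∀ j, 0 ≤ ψ j := fun j => Real.rpow_nonneg (hS0 j) _
  have hψp : ∀ j, ψ j ^ p = ∑ i, a i * φ i j ^ p := by
    intro j; rw [hψ]; dsimp only
    rw [← Real.rpow_mul (hS0 j), mul_comm s p, hps, Real.rpow_one]
  set u : V → Fin k → ℝ := fun i j => φ i j / ψ j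
  have hu0 : ∀ i j, 0 ≤ u i j := fun i j => div_nonneg ((hφ i).1 j) (hψ0 j)
  set z : V → Fin k → ℝ := fun i j => u i j ^ (p - 1)
  have hz0 : ∀ i j, 0 ≤ z i j := fun i j => Real.rpow_nonneg (hu0 i j) _
  have hzr : ∀ i j, z i j ^ (2 * q) = u i j ^ p := by
    intro i j
    simp only [z]
    rw [← Real.rpow_mul (hu0 i j), hr]
  have hsum : ∀ j, ∑ i, a i * z i j ^ (2 * q) ≤ 1 := by
    intro j
    simp only [hzr, u]
    have : ∀ i, a i * (φ i j / ψ j) ^ p = a i * φ i j ^ p / ψ j ^ p := by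
      intro i; rw [Real.div_rpow ((hφ i).1 j) (hψ0 j)]; ring
    simp only [this]
    rw [← sum_div, ← hψp]
    exact div_self_le_one _
  have hrep : ∀ j, ψ j ≤ ∑ i, a i * (φ i j * z i j) := by
    intro j
    rcases (hψ0 j).eq_or_lt with h0 | h0
    · rw [← h0]; exact sum_nonneg fun i _ => mul_nonneg (ha i) (mul_nonneg ((hφ i).1 j) (hz0 i j))
    · have : ∀ i, a i * (φ i j * z i j) = a i * φ i j ^ p / ψ j ^ (p - 1) := by
        intro i
        simp only [z, u]
        rw [Real.div_rpow ((hφ i).1 j) (hψ0 j)]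
        rcases ((hφ i).1 j).eq_or_lt with h1 | h1
        · rw [← h1, Real.zero_rpow (by linarith : p - 1 ≠ 0), Real.zero_rpow (by linarith : p ≠ 0)]; simp
        · rw [Real.rpow_sub h1, Real.rpow_one]; field_simp
      simp only [this]
      rw [← sum_div, ← hψp, ← Real.rpow_sub h0]
      simp
  calc ∑ j, ψ j * x j ≤ ∑ j, (∑ i, a i * (φ i j * z i j)) * x j := by
        apply sum_le_sum; intro j _; exact mul_le_mul_of_nonneg_right (hrep j) (hx j)
    _ = ∑ i, a i * ∑ j, φ i j * (z i j * x j) := by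
        simp only [sum_mul, mul_sum]; rw [sum_comm]
        apply sum_congr rfl; intro i _; apply sum_congr rfl; intro j _; ring
    _ ≤ ∑ i, a i * (5 + 4 * ∑ j, ξ j * x j * z i j ^ (2 * q)) := by
        apply sum_le_sum; intro i _
        apply mul_le_mul_of_nonneg_left _ (ha i)
        exact ((hφ i).2 _ fun j => mul_nonneg (hz0 i j) (hx j)).trans
          (h.mul_le_one hq x hx hPx ξ hξ hξx (z i) (hz0 i))
    _ = 5 * ∑ i, a i + 4 * ∑ j, ξ j * x j * ∑ i, a i * z i j ^ (2 * q) := by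
        simp only [mul_add, sum_add_distrib, mul_sum]
        rw [sum_comm (s := (univ : Finset (Fin k)))]
        congr 1
        · apply sum_congr rfl; intro i _; ring
        · apply sum_congr rfl; intro i _; apply sum_congr rfl; intro j _; ring
    _ ≤ 5 * 1 + 4 * ∑ j, ξ j * x j * 1 := by
        rw [ha1]; gcongr with j _
        · exact mul_nonneg (hξ.1 j) (hx j)
        · exact hsum j
    _ = 9 * P x := by
        simp only [mul_one, hξx, hPx]; norm_num

end LatNorm
end SG
namespace SG

lemma kfun (t w x y : ℝ) (ht : 0 < t) (hw : 0 ≤ w) :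
    t * w / (t + w) * (x + y) ^ 2 ≤ t * x ^ 2 + w * y ^ 2 := by
  have h : 0 < t + w := by linarith
  rw [div_mul_eq_mul_div, div_le_iff₀ h]
  nlinarith [sq_nonneg (t * x - w * y)]

lemma kfun_eq (t w g : ℝ) (ht : 0 < t) (hw : 0 ≤ w) :
    t * (w / (t + w) * g) ^ 2 + w * (t / (t + w) * g) ^ 2 = t * w / (t + w) * g ^ 2 := by
  have h : t + w ≠ 0 := by linarith
  field_simp
  ring

lemma interp {V : Type*} [Fintype V] (T : (V → ℝ) →ₗ[ℝ] (V → ℝ)) (w0 w1 : V → ℝ)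
    (hw0 : ∀ v, 0 ≤ w0 v) (hw1 : ∀ v, 0 ≤ w1 v) (D : ℝ) (hD : 0 < D) (s : ℝ)
    (hs : s ∈ Set.Ioo (0:ℝ) 1)
    (h1 : ∀ g, ∑ v, w1 v * (T g v) ^ 2 ≤ ∑ v, w0 v * (g v) ^ 2)
    (h2 : ∀ g, ∑ v, (T g v) ^ 2 ≤ D * ∑ v, (g v) ^ 2) (g : V → ℝ) :
    ∑ v, w1 v ^ s * (T g v) ^ 2 ≤ D ^ (1 - s) * ∑ v, w0 v ^ s * (g v) ^ 2 := by
  have key : ∀ t : ℝ, 0 < t → ∑ v, (t * w1 v / (t + w1 v)) * (T g v) ^ 2 ≤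
      ∑ v, (t * D * w0 v / (t * D + w0 v)) * (g v) ^ 2 := by
    intro t ht
    have htD : 0 < t * D := by positivity
    set a : V → ℝ := fun v => w0 v / (t * D + w0 v) * g v
    set b : V → ℝ := fun v => t * D / (t * D + w0 v) * g v
    have hab : g = a + b := by
      funext v
      have : t * D + w0 v ≠ 0 := by linarith [hw0 v]
      simp only [a, b, Pi.add_apply]; field_simp; ring
    have hT : ∀ v, T g v = T a v + T b v := by
      intro v; conv_lhs => rw [hab, map_add]
      rfl
    calc _ ≤ ∑ v, (t * (T a v) ^ 2 + w1 v * (T b v) ^ 2) := by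
          apply sum_le_sum; intro v _; rw [hT]; exact kfun _ _ _ _ ht (hw1 v)
      _ = t * ∑ v, (T a v) ^ 2 + ∑ v, w1 v * (T b v) ^ 2 := by
          rw [sum_add_distrib, mul_sum]
      _ ≤ t * (D * ∑ v, (a v) ^ 2) + ∑ v, w0 v * (b v) ^ 2 := by
          exact add_le_add (mul_le_mul_of_nonneg_left (h2 a) ht.le) (h1 b)
      _ = ∑ v, (t * D * (a v) ^ 2 + w0 v * (b v) ^ 2) := by
          rw [sum_add_distrib, ← mul_sum]; ring
      _ = _ := by
          apply sum_congr rfl; intro v _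
          exact kfun_eq (t * D) (w0 v) (g v) htD (hw0 v)
  obtain ⟨C, hC, hCi⟩ : ∃ C : ℝ, 0 < C ∧ ∀ x : ℝ, 0 ≤ x →
      ∫ t in Set.Ioi 0, Real.rpowIntegrand₀₁ s t x = C * x ^ s := by
    refine ⟨∫ t in Set.Ioi 0, Real.rpowIntegrand₀₁ s t 1,
      Real.integral_rpowIntegrand₀₁_one_pos hs, ?_⟩
    intro x hx
    rw [Real.integral_rpowIntegrand₀₁_eq_rpow_mul_const hs hx, mul_comm]
  have hint := fun x (hx : (0:ℝ) ≤ x) => Real.integrableOn_rpowIntegrand₀₁_Ioi hs hx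
  have hw0D : ∀ v, 0 ≤ w0 v / D := fun v => div_nonneg (hw0 v) hD.le
  have hmain : ∫ t in Set.Ioi 0, ∑ v, Real.rpowIntegrand₀₁ s t (w1 v) * (T g v) ^ 2 ≤
      ∫ t in Set.Ioi 0, ∑ v, D * Real.rpowIntegrand₀₁ s t (w0 v / D) * (g v) ^ 2 := by
    apply MeasureTheory.setIntegral_mono_on
    · exact MeasureTheory.integrable_finsetSum _ fun v _ => (hint _ (hw1 v)).mul_const _
    · exact MeasureTheory.integrable_finsetSum _ fun v _ =>
        ((hint _ (hw0D v)).const_mul _).mul_const _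
    · exact measurableSet_Ioi
    · intro t ht
      have ht : 0 < t := ht
      have := mul_le_mul_of_nonneg_left (key t ht) (show 0 ≤ t ^ s * (t⁻¹ * t⁻¹) by positivity)
      rw [mul_sum, mul_sum] at this
      convert this using 1
      · apply sum_congr rfl; intro v _
        have : t + w1 v ≠ 0 := by linarith [hw1 v]
        simp only [Real.rpowIntegrand₀₁]
        field_simp; ring
      · apply sum_congr rfl; intro v _
        have : t * D + w0 v ≠ 0 := by nlinarith [hw0 v, mul_pos ht hD]
        have h5 : D * t + w0 v ≠ 0 := by rwa [mul_comm D t]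
        have h3 : t + w0 v / D ≠ 0 := by have := hw0D v; linarith
        have h4 : (t + w0 v / D)⁻¹ = D / (t * D + w0 v) := by field_simp
        simp only [Real.rpowIntegrand₀₁, h4]
        field_simp; ring
  rw [MeasureTheory.integral_finsetSum _ fun v _ => (hint _ (hw1 v)).mul_const _,
    MeasureTheory.integral_finsetSum _ fun v _ =>
        ((hint _ (hw0D v)).const_mul _).mul_const _] at hmain
  simp only [MeasureTheory.integral_mul_const, MeasureTheory.integral_const_mul] at hmain
  have e1 : ∀ v, (∫ t in Set.Ioi 0, Real.rpowIntegrand₀₁ s t (w1 v)) = C * w1 v ^ s :=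
    fun v => hCi _ (hw1 v)
  have e0 : ∀ v, (∫ t in Set.Ioi 0, Real.rpowIntegrand₀₁ s t (w0 v / D)) = C * (w0 v / D) ^ s :=
    fun v => hCi _ (hw0D v)
  simp only [e1, e0] at hmain
  have hl : ∑ v, C * w1 v ^ s * (T g v) ^ 2 = C * ∑ v, w1 v ^ s * (T g v) ^ 2 := by
    rw [mul_sum]; apply sum_congr rfl; intros; ring
  have hr : ∑ v, D * (C * (w0 v / D) ^ s) * (g v) ^ 2 =
      C * (D ^ (1 - s) * ∑ v, w0 v ^ s * (g v) ^ 2) := by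
    rw [mul_sum, mul_sum]; apply sum_congr rfl; intro v _
    rw [Real.div_rpow (hw0 v) hD.le, Real.rpow_sub hD, Real.rpow_one]
    ring
  rw [hl, hr] at hmain
  exact le_of_mul_le_mul_left hmain hC
end SG
namespace SG
section renorm
variable {k : ℕ} (N : (Fin k → ℝ) → ℝ) (q : ℝ)

noncomputable def sg (b : Bool) : ℝ := if b then 1 else -1

lemma sg_mul (a b : Bool) : sg a * sg b = sg (a == b) := by
  cases a <;> cases b <;> simp [sg]

def Idx (k : ℕ) : Type := Σ m : ℕ, (Fin k → Fin m) × (Fin k → Bool)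

noncomputable def piece {m : ℕ} (c : Fin k → Fin m) (σ : Fin k → Bool) (x : Fin k → ℝ) (i : Fin m) :
    Fin k → ℝ := fun j => if c j = i then sg (σ j) * x j else 0

noncomputable def vsum (I : Idx k) (x : Fin k → ℝ) : ℝ := ∑ i, N (piece I.2.1 I.2.2 x i) ^ q

noncomputable def pnorm (x : Fin k → ℝ) : ℝ := ⨆ I : Idx k, vsum N q I x ^ (1 / q)

instance : Nonempty (Idx k) := ⟨⟨1, (fun _ => 0, fun _ => true)⟩⟩

variable {N q} {C K : ℝ}

lemma isNorm_nonneg (hN : IsNorm k N) (x) : 0 ≤ N x := by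
  have h1 := hN.2.2 x ((-1:ℝ) • x)
  rw [hN.2.1] at h1
  have h2 : x + (-1:ℝ) • x = 0 := by simp
  rw [h2, (hN.1 0).2 rfl] at h1
  norm_num at h1; linarith

lemma vsum_nonneg (hN : IsNorm k N) (I : Idx k) (x) : 0 ≤ vsum N q I x :=
  sum_nonneg fun _ _ => Real.rpow_nonneg (isNorm_nonneg hN _) _

lemma vsum_le (hq : 2 ≤ q) (hC : 1 ≤ C) (hK : 1 ≤ K) (hN : IsNorm k N) (hunc : UncondConst k N K)
    (hcot : HasCotype k N q C) (I : Idx k) (x) : vsum N q I x ≤ (C * K * N x) ^ q := by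
  obtain ⟨m, c, σ⟩ := I
  have h0 := isNorm_nonneg hN x
  have h := hcot m (fun i => piece c σ x i)
  have h2 : ∀ τ : Fin m → Bool, N (∑ i, (if τ i then (1:ℝ) else -1) • piece c σ x i) ^ q ≤
      (K * N x) ^ q := by
    intro τ
    apply Real.rpow_le_rpow (isNorm_nonneg hN _) _ (by linarith)
    have e : ∑ i, (if τ i then (1:ℝ) else -1) • piece c σ x i =
        fun j => (if (τ (c j) == σ j) then (1:ℝ) else -1) * x j := by
      funext j
      have e2 : (if (τ (c j) == σ j) then (1:ℝ) else -1) = sg (τ (c j)) * sg (σ j) := by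
        rw [sg_mul]; rfl
      rw [e2, Finset.sum_apply]
      simp only [Pi.smul_apply, smul_eq_mul, piece, mul_ite, mul_zero]
      rw [Finset.sum_ite_eq]
      simp [sg]
    rw [e]
    exact hunc (fun j => τ (c j) == σ j) x
  have h3 : 1 / 2 ^ m * ∑ τ : Fin m → Bool, N (∑ i, (if τ i then (1:ℝ) else -1) • piece c σ x i) ^ q
      ≤ (K * N x) ^ q := by
    calc _ ≤ 1 / 2 ^ m * ∑ τ : Fin m → Bool, (K * N x) ^ q := by
          exact mul_le_mul_of_nonneg_left (sum_le_sum fun τ _ => h2 τ) (by positivity)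
      _ = _ := by simp
  have h4 := h.trans h3
  have hCq : 0 < C ^ q := Real.rpow_pos_of_pos (by linarith) _
  rw [one_div_mul_eq_div, div_le_iff₀ hCq] at h4
  rw [mul_assoc, Real.mul_rpow (by linarith) (by positivity), mul_comm]
  exact h4

lemma root_pow {a : ℝ} (hq : 2 ≤ q) (ha : 0 ≤ a) : (a ^ q) ^ (1 / q) = a := by
  rw [← Real.rpow_mul ha, mul_one_div_cancel (by linarith), Real.rpow_one]

lemma pow_root {a : ℝ} (hq : 2 ≤ q) (ha : 0 ≤ a) : (a ^ (1 / q)) ^ q = a := by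
  rw [← Real.rpow_mul ha, one_div_mul_cancel (by linarith), Real.rpow_one]

theorem renorm (hq : 2 ≤ q) (hC : 1 ≤ C) (hK : 1 ≤ K) (hN : IsNorm k N) (hunc : UncondConst k N K)
    (hcot : HasCotype k N q C) :
    ∃ P, LatNorm k q P ∧ ∀ x, N x ≤ P x ∧ P x ≤ C * K * N x := by
  have hqp : 0 ≤ 1 / q := by positivity
  have hval : ∀ I x, vsum N q I x ^ (1 / q) ≤ C * K * N x := by
    intro I x
    have h0 := isNorm_nonneg hN x
    rw [← root_pow hq (show 0 ≤ C * K * N x by positivity)]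
    exact Real.rpow_le_rpow (vsum_nonneg hN _ _) (vsum_le hq hC hK hN hunc hcot I x) hqp
  have hbdd : ∀ x, BddAbove (Set.range fun I => vsum N q I x ^ (1 / q)) := by
    intro x; refine ⟨C * K * N x, ?_⟩; rintro _ ⟨I, rfl⟩; exact hval I x
  have hle : ∀ I x, vsum N q I x ^ (1 / q) ≤ pnorm N q x := fun I x => le_ciSup (hbdd x) I
  have hle2 : ∀ x B, (∀ I, vsum N q I x ^ (1 / q) ≤ B) → pnorm N q x ≤ B :=
    fun x B h => ciSup_le h
  have hp0 : ∀ x, 0 ≤ pnorm N q x := fun x =>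
    (Real.rpow_nonneg (vsum_nonneg hN (Classical.arbitrary _) x) _).trans
      (hle (Classical.arbitrary _) x)
  have hleq : ∀ I x, vsum N q I x ≤ pnorm N q x ^ q := by
    intro I x
    rw [← pow_root hq (vsum_nonneg hN I x)]
    exact Real.rpow_le_rpow (Real.rpow_nonneg (vsum_nonneg hN I x) _) (hle I x) (by linarith)
  have hleq2 : ∀ x B, (∀ I, vsum N q I x ≤ B) → pnorm N q x ^ q ≤ B := by
    intro x B h
    have hB : 0 ≤ B := (vsum_nonneg hN (Classical.arbitrary _) x).trans (h (Classical.arbitrary _))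
    rw [← pow_root hq hB]
    apply Real.rpow_le_rpow (hp0 x) _ (by linarith)
    apply hle2; intro I
    exact Real.rpow_le_rpow (vsum_nonneg hN I x) (h I) hqp
  have hNle : ∀ x, N x ≤ pnorm N q x := by
    intro x
    have := hle ⟨1, (fun _ => 0, fun _ => true)⟩ x
    have e : vsum N q ⟨1, (fun _ => 0, fun _ => true)⟩ x = N x ^ q := by
      have e1 : piece (fun _ => (0 : Fin 1)) (fun _ => true) x 0 = x := by
        funext j; simp [piece, sg]
      simp [vsum, e1]
    rwa [e, root_pow hq (isNorm_nonneg hN x)] at this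
  have hadd : ∀ x y, pnorm N q (x + y) ≤ pnorm N q x + pnorm N q y := by
    intro x y; apply hle2; intro I
    refine le_trans ?_ (add_le_add (hle I x) (hle I y))
    refine le_trans ?_ (Real.Lp_add_le_of_nonneg univ (by linarith : 1 ≤ q)
      (fun i _ => isNorm_nonneg hN (piece I.2.1 I.2.2 x i))
      (fun i _ => isNorm_nonneg hN (piece I.2.1 I.2.2 y i)))
    apply Real.rpow_le_rpow (vsum_nonneg hN _ _) _ hqp
    apply sum_le_sum; intro i _
    apply Real.rpow_le_rpow (isNorm_nonneg hN _) _ (by linarith)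
    have e : piece I.2.1 I.2.2 (x + y) i = piece I.2.1 I.2.2 x i + piece I.2.1 I.2.2 y i := by
      funext j; simp only [piece, Pi.add_apply]; split_ifs <;> ring
    rw [e]; exact hN.2.2 _ _
  have hsmul1 : ∀ (c : ℝ) x, pnorm N q (c • x) ≤ |c| * pnorm N q x := by
    intro c x; apply hle2; intro I
    have e : vsum N q I (c • x) = |c| ^ q * vsum N q I x := by
      simp only [vsum, mul_sum]; apply sum_congr rfl; intro i _
      have e : piece I.2.1 I.2.2 (c • x) i = c • piece I.2.1 I.2.2 x i := by
        funext j; simp only [piece, Pi.smul_apply, smul_eq_mul]; split_ifs <;> ring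
      rw [e, hN.2.1, Real.mul_rpow (abs_nonneg c) (isNorm_nonneg hN _)]
    rw [e, Real.mul_rpow (Real.rpow_nonneg (abs_nonneg c) _) (vsum_nonneg hN _ _),
      root_pow hq (abs_nonneg c)]
    exact mul_le_mul_of_nonneg_left (hle I x) (abs_nonneg c)
  have hsmul : ∀ (c : ℝ) x, pnorm N q (c • x) = |c| * pnorm N q x := by
    intro c x
    refine le_antisymm (hsmul1 c x) ?_
    by_cases hc : c = 0
    · simp [hc, hp0]
    have h1 := hsmul1 c⁻¹ (c • x)
    rw [smul_smul, inv_mul_cancel₀ hc, one_smul, abs_inv] at h1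
    have hc' : 0 < |c| := abs_pos.2 hc
    rw [← div_eq_inv_mul, le_div_iff₀ hc'] at h1
    linarith
  have hflip : ∀ (u : Fin k → ℝ) a, pnorm N q (Function.update u a (- u a)) ≤ pnorm N q u := by
    intro u a; apply hle2; rintro ⟨m, c, σ⟩
    have e : vsum N q ⟨m, c, σ⟩ (Function.update u a (- u a)) =
        vsum N q ⟨m, c, Function.update σ a (!σ a)⟩ u := by
      simp only [vsum]; apply sum_congr rfl; intro i _
      congr 2
      funext j
      simp only [piece]
      by_cases hj : j = a
      · subst hj
        simp only [Function.update_self]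
        cases σ j <;> simp [sg]
      · simp [Function.update_of_ne hj]
    rw [e]; exact hle _ u
  have hupd : ∀ (u : Fin k → ℝ) a b, |b| ≤ |u a| → pnorm N q (Function.update u a b) ≤ pnorm N q u := by
    intro u a b hb
    by_cases hu : u a = 0
    · rw [hu, abs_zero, abs_nonpos_iff] at hb
      rw [hb, ← hu, Function.update_eq_self]
    set l := (1 + b / u a) / 2 with hl
    have hba : |b / u a| ≤ 1 := by rw [abs_div]; exact div_le_one_of_le₀ hb (abs_nonneg _)
    rw [abs_le] at hba
    have e : Function.update u a b = l • u + (1 - l) • Function.update u a (- u a) := by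
      funext j
      by_cases hj : j = a
      · subst hj
        simp only [Function.update_self, Pi.add_apply, Pi.smul_apply, smul_eq_mul, hl]
        field_simp; ring
      · simp [Function.update_of_ne hj]
        ring
    rw [e]
    refine (hadd _ _).trans ?_
    rw [hsmul, hsmul, abs_of_nonneg (by linarith), abs_of_nonneg (by linarith)]
    have := mul_le_mul_of_nonneg_left (hflip u a) (by linarith : 0 ≤ 1 - l)
    linarith
  have hmono : ∀ x y, (∀ j, |y j| ≤ |x j|) → pnorm N q y ≤ pnorm N q x := by
    intro x y hxy
    have h : ∀ s : Finset (Fin k), pnorm N q (fun j => if j ∈ s then y j else x j) ≤ pnorm N q x := by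
      intro s
      induction s using Finset.induction_on with
      | empty => simp
      | insert a s ha ih =>
        refine le_trans (le_of_eq ?_) ((hupd (fun j => if j ∈ s then y j else x j) a (y a)
          (by simpa [ha] using hxy a)).trans ih)
        congr 1; funext j
        by_cases hj : j = a
        · subst hj; simp
        · simp [hj]
    simpa using h univ
  refine ⟨pnorm N q, ⟨hadd, hsmul, hmono, ?_, ?_⟩, fun x => ⟨hNle x, hle2 _ _ fun I => hval I x⟩⟩
  · intro x hx
    exact (hN.1 x).1 (le_antisymm (hx ▸ hNle x) (isNorm_nonneg hN x))
  · intro B _ x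
    rw [← le_sub_iff_add_le]
    apply hleq2; rintro ⟨m1, c1, σ1⟩
    rw [le_sub_iff_add_le, add_comm, ← le_sub_iff_add_le]
    apply hleq2; rintro ⟨m2, c2, σ2⟩
    rw [le_sub_iff_add_le, add_comm]
    refine le_trans (le_of_eq ?_) (hleq ⟨m1 + m2,
      (fun j => if B j then Fin.castAdd m2 (c1 j) else Fin.natAdd m1 (c2 j)),
      (fun j => if B j then σ1 j else σ2 j)⟩ x)
    simp only [vsum]
    rw [Fin.sum_univ_add]
    congr 1
    · apply sum_congr rfl; intro i _
      congr 2; funext j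
      by_cases hB : B j
      · simp [piece, hB]
      · have : Fin.natAdd m1 (c2 j) ≠ Fin.castAdd m2 i := by
          intro h; have := congrArg Fin.val h; simp at this; omega
        simp [piece, hB, this]
    · apply sum_congr rfl; intro i _
      congr 2; funext j
      by_cases hB : B j
      · have : Fin.castAdd m2 (c1 j) ≠ Fin.natAdd m1 i := by
          intro h; have := congrArg Fin.val h; simp at this; omega
        simp [piece, hB, this]
      · simp [piece, hB]

end renorm
end SG

namespace SG
section cheeger
variable {n d : ℕ} (G : SimpleGraph (Fin n)) [DecidableRel G.Adj]

noncomputable def adj (v w : Fin n) : ℝ := if G.Adj v w then 1 else 0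

lemma adj_symm (v w) : adj G v w = adj G w v := by simp [adj, G.adj_comm]
lemma adj_nonneg (v w) : 0 ≤ adj G v w := by unfold adj; split_ifs <;> norm_num

lemma adj_sum (hreg : ∀ v, G.degree v = d) (v) : ∑ w, adj G v w = d := by
  simp only [adj, sum_boole]
  rw [← hreg v, ← SimpleGraph.card_neighborFinset_eq_degree]
  congr 2; ext w; simp

def cutset (S : Finset (Fin n)) : Finset (Fin n × Fin n) :=
  univ.filter fun p => p.1 ∈ S ∧ p.2 ∉ S ∧ G.Adj p.1 p.2

noncomputable def ballS (S : Finset (Fin n)) (i : ℕ) : Finset (Fin n) :=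
  univ.filter fun v => vertexSetDist G v S ≤ (i : ℕ∞)

lemma mem_ballS (S : Finset (Fin n)) (i : ℕ) (v) :
    v ∈ ballS G S i ↔ ∃ w ∈ S, G.edist v w ≤ i := by
  simp only [ballS, mem_filter, mem_univ, true_and]
  unfold vertexSetDist
  rw [Finset.inf_le_iff (by simp)]

lemma ball_step (hreg : ∀ v, G.degree v = d) (S : Finset (Fin n)) (i : ℕ) :
    (ballS G S (i + 1) \ S).card ≤ (d + 1) * (ballS G S i \ S).card + (cutset G S).card := by
  have hsub : ballS G S (i + 1) \ S ⊆ ((ballS G S i \ S) ∪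
      (ballS G S i \ S).biUnion fun u => G.neighborFinset u) ∪ (cutset G S).image Prod.snd := by
    intro v hv
    rw [mem_sdiff, mem_ballS] at hv
    obtain ⟨⟨w, hw, hvw⟩, hvS⟩ := hv
    obtain ⟨p, hp⟩ := SimpleGraph.exists_walk_of_edist_ne_top
      (ne_top_of_le_ne_top (by simp) hvw)
    rw [← hp] at hvw
    cases p with
    | nil => exact absurd hw hvS
    | @cons _ u _ h p =>
      have hp' : p.length ≤ i := by
        have : ((p.length + 1 : ℕ) : ℕ∞) ≤ ((i + 1 : ℕ) : ℕ∞) := by simpa using hvw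
        have := Nat.cast_le.1 this
        omega
      have hu : u ∈ ballS G S i := by
        rw [mem_ballS]
        exact ⟨w, hw, (SimpleGraph.edist_le p).trans (by exact_mod_cast hp')⟩
      rw [mem_union, mem_union, mem_biUnion, mem_image]
      by_cases huS : u ∈ S
      · right; exact ⟨(u, v), by simp [cutset, huS, hvS, h.symm], rfl⟩
      · left; right; exact ⟨u, by simp [hu, huS], by simp [h.symm]⟩
  refine (card_le_card hsub).trans ((card_union_le _ _).trans ?_)
  refine add_le_add ((card_union_le _ _).trans ?_) card_image_le
  have h1 : ((ballS G S i \ S).biUnion fun u => G.neighborFinset u).card ≤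
      (ballS G S i \ S).card * d := by
    apply card_biUnion_le_card_mul
    intro u _; rw [SimpleGraph.card_neighborFinset_eq_degree, hreg]
  calc _ ≤ (ballS G S i \ S).card + (ballS G S i \ S).card * d := by gcongr
    _ = _ := by ring

lemma ball_bound (hd : 3 ≤ d) (hreg : ∀ v, G.degree v = d) (S : Finset (Fin n)) (i : ℕ) :
    (ballS G S i \ S).card + (cutset G S).card ≤ (cutset G S).card * (d + 1) ^ i := by
  induction i with
  | zero =>
    have : ballS G S 0 \ S = ∅ := by
      rw [sdiff_eq_empty_iff_subset]
      intro v hv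
      rw [mem_ballS] at hv
      obtain ⟨w, hw, h⟩ := hv
      have : v = w := by simpa using h
      rwa [this]
    simp [this]
  | succ i ih =>
    have h := ball_step G hreg S i
    rw [pow_succ]
    have h1 : (cutset G S).card ≤ d * (cutset G S).card := Nat.le_mul_of_pos_left _ (by omega)
    have h2 := Nat.mul_le_mul_left (d + 1) ih
    calc _ ≤ (d + 1) * ((ballS G S i \ S).card + (cutset G S).card) := by
          rw [mul_add, add_mul d 1 (cutset G S).card]; omega
      _ ≤ _ := h2
      _ = _ := by ring

lemma cut_bound (hd : 3 ≤ d) (hreg : ∀ v, G.degree v = d) {α : ℝ} (hα : 0 < α ∧ α ≤ 1)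
    (hA : ExpanA n d G α) (S : Finset (Fin n)) (hS : 2 * S.card ≤ n) :
    α ^ 2 / (8 * d ^ 2) * S.card ≤ (cutset G S).card := by
  rcases S.eq_empty_or_nonempty with rfl | hne
  · simp
  have hdr : (3:ℝ) ≤ d := by exact_mod_cast hd
  have hα0 := hα.1
  have hex : ∃ l : ℕ, 2 / α ≤ ((d:ℝ) - 1) ^ l := by
    obtain ⟨l, hl⟩ := pow_unbounded_of_one_lt (2 / α) (by linarith : 1 < (d:ℝ) - 1)
    exact ⟨l, hl.le⟩
  classical
  obtain ⟨l, hl1, hl2⟩ : ∃ l : ℕ, 2 / α ≤ ((d:ℝ) - 1) ^ (l + 1) ∧ ((d:ℝ) - 1) ^ l ≤ 2 / α := by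
    have h1 := Nat.find_spec hex
    have h2 := fun m => Nat.find_min hex (m := m)
    rcases hm : Nat.find hex with _ | l
    · rw [hm, pow_zero, div_le_one hα0] at h1
      linarith [hα.2]
    · exact ⟨l, hm ▸ h1, (not_le.1 (h2 l (by omega))).le⟩
  have hb := ball_bound G hd hreg S (l + 1)
  have hAS := hA S hne (l + 1) (by omega)
  have hcardS : (0:ℝ) < S.card := by exact_mod_cast hne.card_pos
  have hS' : 2 * (S.card : ℝ) ≤ n := by exact_mod_cast hS
  have h1 : (3/2:ℝ) * S.card ≤ (ballS G S (l + 1)).card := by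
    refine le_trans (le_min ?_ ?_) hAS
    · linarith
    · rw [div_le_iff₀ hα0] at hl1
      nlinarith
  have h2 : ((ballS G S (l + 1)).card : ℝ) ≤ (ballS G S (l + 1) \ S).card + S.card := by
    exact_mod_cast card_le_card_sdiff_add_card
  have h3 : ((ballS G S (l + 1) \ S).card : ℝ) ≤ (cutset G S).card * ((d:ℝ) + 1) ^ (l + 1) := by
    exact_mod_cast (Nat.le_add_right _ _).trans hb
  have h4 : ((d:ℝ) + 1) ^ (l + 1) ≤ 4 * d ^ 2 / α ^ 2 := by
    calc ((d:ℝ) + 1) ^ (l + 1) ≤ (((d:ℝ) - 1) ^ 2) ^ (l + 1) := by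
          apply pow_le_pow_left₀ (by linarith); nlinarith
      _ = (((d:ℝ) - 1) ^ l * (d - 1)) ^ 2 := by rw [← pow_succ, ← pow_mul, ← pow_mul, mul_comm]
      _ ≤ (2 / α * d) ^ 2 := by
          apply pow_le_pow_left₀ (by apply mul_nonneg; apply pow_nonneg; all_goals linarith)
          apply mul_le_mul hl2 (by linarith) (by linarith) (by positivity)
      _ = _ := by ring
  have h5 : (S.card : ℝ) / 2 ≤ (cutset G S).card * (4 * d ^ 2 / α ^ 2) := by
    calc _ ≤ ((cutset G S).card : ℝ) * ((d:ℝ) + 1) ^ (l + 1) := by linarith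
      _ ≤ _ := by gcongr
  have h6 : (0:ℝ) < d := by linarith
  rw [div_mul_eq_mul_div, div_le_iff₀ (by positivity)]
  rw [mul_div_assoc', le_div_iff₀ (by positivity)] at h5
  nlinarith

noncomputable def ind (p : Prop) : ℝ := if p then 1 else 0

lemma l1_ind {η : ℝ} (hη : 0 < η)
    (hcut : ∀ S : Finset (Fin n), 2 * S.card ≤ n → η * S.card ≤ (cutset G S).card)
    (S : Finset (Fin n)) :
    η * ∑ v, ∑ w, |ind (v ∈ S) - ind (w ∈ S)| ≤
      n * ∑ v, ∑ w, adj G v w * |ind (v ∈ S) - ind (w ∈ S)| := by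
  have hgen : ∀ κ : Fin n → Fin n → ℝ, (∀ v w, κ v w = κ w v) →
      ∑ v, ∑ w, κ v w * |ind (v ∈ S) - ind (w ∈ S)| =
      2 * ∑ v, ∑ w, κ v w * (ind (v ∈ S) * (1 - ind (w ∈ S))) := by
    intro κ hκ
    have h1 : ∑ v, ∑ w, κ v w * (ind (v ∈ S) * (1 - ind (w ∈ S))) =
        ∑ v, ∑ w, κ v w * (ind (w ∈ S) * (1 - ind (v ∈ S))) := by
      rw [sum_comm]; apply sum_congr rfl; intro v _; apply sum_congr rfl; intro w _
      rw [hκ]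
    rw [two_mul]; nth_rewrite 2 [h1]
    rw [← sum_add_distrib]; apply sum_congr rfl; intro v _
    rw [← sum_add_distrib]; apply sum_congr rfl; intro w _
    rw [← mul_add]; congr 1
    unfold ind; split_ifs <;> norm_num
  have hL := hgen (fun _ _ => 1) (fun _ _ => rfl)
  simp only [one_mul] at hL
  rw [hL, hgen _ (adj_symm G)]
  have hsumS : ∀ S : Finset (Fin n), ∑ v, ind (v ∈ S) = S.card := by
    intro S
    rw [← Finset.sum_subset (subset_univ S) (f := fun v => ind (v ∈ S)) (by
      intro v _ h; simp [ind, h])]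
    rw [sum_congr rfl (g := fun _ => (1:ℝ)) (by intro v h; simp [ind, h])]
    simp
  have hL2 : ∑ v, ∑ w, (ind (v ∈ S) * (1 - ind (w ∈ S))) = S.card * (n - S.card : ℝ) := by
    simp only [← mul_sum, ← sum_mul, sum_sub_distrib, hsumS]; simp
  have hcard : ∀ S : Finset (Fin n), ∑ v, ∑ w, adj G v w * (ind (v ∈ S) * (1 - ind (w ∈ S))) =
      (cutset G S).card := by
    intro S
    rw [cutset, card_filter, ← Finset.univ_product_univ, sum_product]
    push_cast
    apply sum_congr rfl; intro v _; apply sum_congr rfl; intro w _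
    unfold adj ind
    by_cases h1 : v ∈ S <;> by_cases h2 : w ∈ S <;> by_cases h3 : G.Adj v w <;> simp [h1, h2, h3]
  have hcompl : ((cutset G Sᶜ).card : ℝ) = (cutset G S).card := by
    rw [← hcard, ← hcard, sum_comm]
    apply sum_congr rfl; intro v _; apply sum_congr rfl; intro w _
    rw [adj_symm]; congr 1
    unfold ind; by_cases h1 : v ∈ S <;> by_cases h2 : w ∈ S <;> simp [h1, h2]
  rw [hL2, hcard]
  have hSn : (S.card : ℝ) ≤ n := by
    have := card_le_univ S; simp at this; exact_mod_cast this
  have hS0 : (0:ℝ) ≤ S.card := by positivity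
  rcases le_total (2 * S.card) n with h | h
  · have := hcut S h
    have hη' : η * (S.card * (n - S.card)) ≤ n * (η * S.card) := by
      have : 0 ≤ η * S.card * S.card := by positivity
      nlinarith
    nlinarith
  · have hc : Sᶜ.card = n - S.card := by rw [card_compl]; simp
    have := hcut Sᶜ (by omega)
    rw [hcompl] at this
    have hc' : (Sᶜ.card : ℝ) = n - S.card := by
      rw [hc, Nat.cast_sub (by exact_mod_cast hSn)]
    rw [hc'] at this
    have h1 : 0 ≤ η * (n - S.card) := mul_nonneg hη.le (by linarith)
    have hη' : η * (S.card * (n - S.card)) ≤ n * (η * (n - S.card)) := by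
      nlinarith
    nlinarith

lemma l1_poincare {η : ℝ} (hη : 0 < η)
    (hcut : ∀ S : Finset (Fin n), 2 * S.card ≤ n → η * S.card ≤ (cutset G S).card)
    (u : Fin n → ℝ) :
    η * ∑ v, ∑ w, |u v - u w| ≤ n * ∑ v, ∑ w, adj G v w * |u v - u w| := by
  let F : ℝ → ℝ → ℝ → ℝ := fun a b => (Set.Ico (min a b) (max a b)).indicator fun _ => (1:ℝ)
  have hF : ∀ a b t, F a b t = |ind (t < a) - ind (t < b)| := by
    intro a b t
    simp only [F, Set.indicator_apply, Set.mem_Ico, min_le_iff, lt_max_iff, ind]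
    by_cases h1 : t < a <;> by_cases h2 : t < b <;> simp [h1, h2, not_le.2, not_lt.1]
  have hFi : ∀ a b, MeasureTheory.Integrable (F a b) := by
    intro a b
    rw [MeasureTheory.integrable_indicator_iff measurableSet_Ico]
    simp
  have hFv : ∀ a b, ∫ t, F a b t = |a - b| := by
    intro a b
    simp only [F]
    rw [MeasureTheory.integral_indicator measurableSet_Ico]
    simp [max_sub_min_eq_abs]
    exact abs_sub_comm _ _
  have hmain : ∫ t, η * ∑ v, ∑ w, F (u v) (u w) t ≤ ∫ t, n * ∑ v, ∑ w, adj G v w * F (u v) (u w) t := by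
    apply MeasureTheory.integral_mono
    · exact (MeasureTheory.integrable_finsetSum _ fun v _ =>
        MeasureTheory.integrable_finsetSum _ fun w _ => hFi _ _).const_mul _
    · exact (MeasureTheory.integrable_finsetSum _ fun v _ =>
        MeasureTheory.integrable_finsetSum _ fun w _ => (hFi _ _).const_mul _).const_mul _
    · intro t
      have := l1_ind G hη hcut (univ.filter fun v => t < u v)
      simpa [hF] using this
  rw [MeasureTheory.integral_const_mul, MeasureTheory.integral_const_mul,
    MeasureTheory.integral_finsetSum _ fun v _ =>
        MeasureTheory.integrable_finsetSum _ fun w _ => hFi _ _,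
    MeasureTheory.integral_finsetSum _ fun v _ =>
        MeasureTheory.integrable_finsetSum _ fun w _ => (hFi _ _).const_mul _] at hmain
  have e1 : ∀ v, ∫ t, ∑ w, F (u v) (u w) t = ∑ w, |u v - u w| := by
    intro v; rw [MeasureTheory.integral_finsetSum _ fun w _ => hFi _ _]; simp only [hFv]
  have e2 : ∀ v, ∫ t, ∑ w, adj G v w * F (u v) (u w) t = ∑ w, adj G v w * |u v - u w| := by
    intro v; rw [MeasureTheory.integral_finsetSum _ fun w _ => (hFi _ _).const_mul _]
    simp only [MeasureTheory.integral_const_mul, hFv]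
  simpa only [e1, e2] using hmain

lemma sq_diff (a b : ℝ) : abs (a * |a| - b * |b|) ≤ |a - b| * (|a| + |b|) := by
  rcases le_total 0 a with ha | ha <;> rcases le_total 0 b with hb | hb <;>
  simp only [abs_of_nonneg, abs_of_nonpos, ha, hb] <;>
  rcases le_total a b with h | h <;>
  (first | rw [abs_of_nonneg (by linarith : 0 ≤ a - b)] | rw [abs_of_nonpos (by linarith : a - b ≤ 0)]) <;>
  rw [abs_le] <;> constructor <;> nlinarith

lemma l2_poincare (hd : 3 ≤ d) (hreg : ∀ v, G.degree v = d) {η : ℝ} (hη : 0 < η)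
    (hcut : ∀ S : Finset (Fin n), 2 * S.card ≤ n → η * S.card ≤ (cutset G S).card)
    (g : Fin n → ℝ) (hg : ∑ v, g v = 0) :
    ∑ v, g v ^ 2 ≤ 4 * d / η ^ 2 * ∑ v, ∑ w, adj G v w * (g v - g w) ^ 2 := by
  have hdr : (3:ℝ) ≤ d := by exact_mod_cast hd
  rcases Nat.eq_zero_or_pos n with rfl | hn
  · simp
  have hnr : (0:ℝ) < n := by exact_mod_cast hn
  obtain ⟨c, hc⟩ : ∃ c : ℝ, ∑ v, (g v - c) * |g v - c| = 0 := by
    have hcont : Continuous fun c : ℝ => ∑ v, (g v - c) * |g v - c| := by fun_prop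
    have hB : ∀ v, |g v| ≤ ∑ v, |g v| := fun v =>
      single_le_sum (f := fun v => |g v|) (fun i _ => abs_nonneg _) (mem_univ v)
    have := mem_range_of_exists_le_of_exists_ge (c := 0) hcont
      ⟨∑ v, |g v|, sum_nonpos fun v _ => mul_nonpos_of_nonpos_of_nonneg
        (by linarith [le_abs_self (g v), hB v]) (abs_nonneg _)⟩
      ⟨-∑ v, |g v|, sum_nonneg fun v _ => mul_nonneg
        (by linarith [neg_abs_le (g v), hB v]) (abs_nonneg _)⟩
    exact this
  set h : Fin n → ℝ := fun v => g v - c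
  set u : Fin n → ℝ := fun v => h v * |h v|
  have hu : ∑ v, u v = 0 := hc
  have h1 := l1_poincare G hη hcut u
  have h2 : n * ∑ v, h v ^ 2 ≤ ∑ v, ∑ w, |u v - u w| := by
    rw [mul_sum]; apply sum_le_sum; intro v _
    calc n * h v ^ 2 = |∑ w, (u v - u w)| := by
          rw [sum_sub_distrib, hu]; simp [u, abs_mul]; ring_nf; simp
      _ ≤ _ := abs_sum_le_sum_abs _ _
  set Q := ∑ v, ∑ w, adj G v w * (g v - g w) ^ 2
  set H := ∑ v, h v ^ 2
  have h3 : ∑ v, ∑ w, adj G v w * |u v - u w| ≤ 2 * d / η * Q + η / (8 * d) * (4 * d * H) := by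
    have hp : ∀ v w, |u v - u w| ≤ 2 * d / η * (g v - g w) ^ 2 +
        η / (8 * d) * (2 * h v ^ 2 + 2 * h w ^ 2) := by
      intro v w
      refine (sq_diff (h v) (h w)).trans ?_
      have e : h v - h w = g v - g w := by simp [h]
      rw [e]
      set A := |g v - g w|
      set B := |h v| + |h w|
      have hA : (g v - g w) ^ 2 = A ^ 2 := (sq_abs _).symm
      have hB : B ^ 2 ≤ 2 * h v ^ 2 + 2 * h w ^ 2 := by
        have := sq_abs (h v); have := sq_abs (h w); simp only [B]; nlinarith [sq_nonneg (|h v| - |h w|)]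
      rw [hA]
      have hx : A * B ≤ 2 * d / η * A ^ 2 + η / (8 * d) * B ^ 2 := by
        have : 2 * d / η * A ^ 2 + η / (8 * d) * B ^ 2 - A * B =
            (4 * d * A - η * B) ^ 2 / (8 * d * η) := by field_simp; ring
        have h0 : 0 ≤ (4 * d * A - η * B) ^ 2 / (8 * d * η) := by positivity
        linarith
      refine hx.trans ?_
      gcongr
    have hsum1 : ∑ v, ∑ w, adj G v w * h v ^ 2 = d * H := by
      simp only [← sum_mul, adj_sum G hreg]; rw [mul_sum]
    have hsum2 : ∑ v, ∑ w, adj G v w * h w ^ 2 = d * H := by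
      rw [sum_comm, ← hsum1]; apply sum_congr rfl; intro v _; apply sum_congr rfl; intro w _
      rw [adj_symm]
    calc _ ≤ ∑ v, ∑ w, adj G v w * (2 * d / η * (g v - g w) ^ 2 +
        η / (8 * d) * (2 * h v ^ 2 + 2 * h w ^ 2)) := by
          apply sum_le_sum; intro v _; apply sum_le_sum; intro w _
          exact mul_le_mul_of_nonneg_left (hp v w) (adj_nonneg G v w)
      _ = 2 * d / η * Q + η / (8 * d) * (2 * ∑ v, ∑ w, adj G v w * h v ^ 2 +
            2 * ∑ v, ∑ w, adj G v w * h w ^ 2) := by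
          simp only [Q, mul_sum, ← sum_add_distrib]
          apply sum_congr rfl; intro v _; apply sum_congr rfl; intro w _; ring
      _ = _ := by rw [hsum1, hsum2]; ring
  have h4 : η * H ≤ 2 * d / η * Q + η / (8 * d) * (4 * d * H) := by
    have : n * (η * H) ≤ n * (2 * d / η * Q + η / (8 * d) * (4 * d * H)) := by
      calc n * (η * H) = η * (n * H) := by ring
        _ ≤ _ := mul_le_mul_of_nonneg_left h2 hη.le
        _ ≤ _ := h1
        _ ≤ _ := by gcongr
    exact le_of_mul_le_mul_left this hnr
  have h5 : H ≤ 4 * d / η ^ 2 * Q := by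
    have e1 : η / (8 * d) * (4 * d * H) = η * H / 2 := by field_simp; ring
    rw [e1] at h4
    have e2 : 4 * d / η ^ 2 * Q = (2 / η) * (2 * d / η * Q) := by field_simp; ring
    rw [e2]
    calc H = (2 / η) * (η * H / 2) := by field_simp
      _ ≤ _ := by gcongr; linarith
  refine le_trans ?_ h5
  have : H = ∑ v, g v ^ 2 + n * c ^ 2 := by
    have e : ∀ v, h v ^ 2 = g v ^ 2 - 2 * c * g v + c ^ 2 := by intro v; simp only [h]; ring
    simp only [H, e, sum_add_distrib, sum_sub_distrib, ← mul_sum, hg]; simp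
  rw [this]
  have : 0 ≤ n * c ^ 2 := by positivity
  linarith
end cheeger
end SG
namespace SG
section contr
variable {n k : ℕ} {q : ℝ} {P : (Fin k → ℝ) → ℝ}

noncomputable def En (P : (Fin k → ℝ) → ℝ) (h : Matrix (Fin n) (Fin k) ℝ) : ℝ :=
  ∑ v, P (fun j => h v j ^ 2)

lemma mono_sq (hP : LatNorm k q P) {x y : Fin k → ℝ} (hy : ∀ j, 0 ≤ y j) (h : ∀ j, y j ≤ x j) :
    P y ≤ P x := by
  apply hP.mono; intro j
  rw [abs_of_nonneg (hy j), abs_of_nonneg ((hy j).trans (h j))]; exact h j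

lemma sum_smul_le (hP : LatNorm k q P) {ι : Type*} [Fintype ι] (a : ι → ℝ) (ha : ∀ i, 0 ≤ a i)
    (x : ι → Fin k → ℝ) (y : Fin k → ℝ) (hy : ∀ j, 0 ≤ y j)
    (h : ∀ j, y j ≤ ∑ i, a i * x i j) : P y ≤ ∑ i, a i * P (x i) := by
  calc P y ≤ P (∑ i, a i • x i) := by
        apply mono_sq hP hy; intro j; simpa [Finset.sum_apply] using h j
    _ ≤ ∑ i, P (a i • x i) := hP.sum_le _ _
    _ = _ := by apply sum_congr rfl; intro i _; rw [hP.smul_of_nonneg (ha i)]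

lemma sq_add_le (hP : LatNorm k q P) (x y z : Fin k → ℝ) (h : ∀ j, z j = x j + y j) :
    P (fun j => z j ^ 2) ≤ 2 * P (fun j => x j ^ 2) + 2 * P (fun j => y j ^ 2) := by
  have := sum_smul_le hP (fun _ : Bool => (2:ℝ)) (fun _ => by norm_num)
    (fun b j => (if b then x j else y j) ^ 2) (fun j => z j ^ 2) (fun j => sq_nonneg _)
    (fun j => by simp only [Fintype.sum_bool, h]; simp; nlinarith [sq_nonneg (x j - y j)])
  simpa using this

lemma En_nonneg (hP : LatNorm k q P) (h : Matrix (Fin n) (Fin k) ℝ) : 0 ≤ En P h :=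
  sum_nonneg fun _ _ => hP.nonneg _

lemma En_add (hP : LatNorm k q P) (a b : Matrix (Fin n) (Fin k) ℝ) :
    En P (a + b) ≤ 2 * En P a + 2 * En P b := by
  unfold En
  rw [mul_sum, mul_sum, ← sum_add_distrib]
  apply sum_le_sum; intro v _
  exact sq_add_le hP (a v) (b v) _ (fun j => rfl)

lemma En_sum (hP : LatNorm k q P) (m : ℕ) (a : ℕ → Matrix (Fin n) (Fin k) ℝ) :
    En P (∑ i ∈ range m, a i) ≤ m * ∑ i ∈ range m, En P (a i) := by
  unfold En
  rw [sum_comm, mul_sum]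
  apply sum_le_sum; intro v _
  have h1 := sum_smul_le hP (fun _ : Fin m => (m:ℝ)) (fun _ => by positivity)
    (fun i j => a i v j ^ 2) (fun j => (∑ i ∈ range m, a i) v j ^ 2) (fun j => sq_nonneg _)
    (fun j => by
      rw [Matrix.sum_apply, ← Fin.sum_univ_eq_sum_range (fun i => a i v j), ← mul_sum]
      have := sq_sum_le_card_mul_sum_sq (s := (univ : Finset (Fin m))) (f := fun i => a i v j)
      simpa using this)
  rw [← mul_sum, Fin.sum_univ_eq_sum_range (fun i => P fun j => a i v j ^ 2)] at h1
  exact h1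

lemma jensen {ι : Type*} [Fintype ι] (a g : ι → ℝ) (ha : ∀ i, 0 ≤ a i) (h1 : ∑ i, a i = 1) :
    (∑ i, a i * g i) ^ 2 ≤ ∑ i, a i * g i ^ 2 :=
  Real.pow_arith_mean_le_arith_mean_pow_of_even univ a g (fun i _ => ha i) h1 (by decide)

lemma En_stoch (hP : LatNorm k q P) (A : Matrix (Fin n) (Fin n) ℝ)
    (hA : A ∈ doublyStochastic ℝ (Fin n)) (h : Matrix (Fin n) (Fin k) ℝ) :
    En P (A * h) ≤ En P h := by
  have hA0 := fun v w => nonneg_of_mem_doublyStochastic hA (i := v) (j := w)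
  unfold En
  calc _ ≤ ∑ v, ∑ w, A v w * P (fun j => h w j ^ 2) := by
        apply sum_le_sum; intro v _
        apply sum_smul_le hP _ (hA0 v) _ _ (fun j => sq_nonneg _)
        intro j
        rw [Matrix.mul_apply]
        exact jensen _ _ (hA0 v) (sum_row_of_mem_doublyStochastic hA v)
    _ = _ := by
        rw [sum_comm]; apply sum_congr rfl; intro w _
        rw [← sum_mul, sum_col_of_mem_doublyStochastic hA, one_mul]

noncomputable def Jm (n : ℕ) : Matrix (Fin n) (Fin n) ℝ := Matrix.of fun _ _ => 1 / (n:ℝ)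

lemma contr_main (hP : LatNorm k q P) (hq : 2 ≤ q) (hn : 0 < n) (A : Matrix (Fin n) (Fin n) ℝ)
    (hA : A ∈ doublyStochastic ℝ (Fin n)) (D : ℝ) (hD : 0 < D)
    (hAD : ∀ g : Fin n → ℝ, ∑ v, (Matrix.mulVec (A - Jm n) g v) ^ 2 ≤ D * ∑ v, g v ^ 2)
    (h : Matrix (Fin n) (Fin k) ℝ) :
    En P ((A - Jm n) * h) ≤ 36 * D ^ (1 / (2 * q)) * En P h := by
  have hnr : (0:ℝ) < n := by exact_mod_cast hn
  have hA0 := fun v w => nonneg_of_mem_doublyStochastic hA (i := v) (j := w)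
  set s : ℝ := 1 - 1 / (2 * q) with hs
  set p : ℝ := 1 / s with hp
  have hq0 : 0 < 1 / (2 * q) := by positivity
  have hs0 : 0 < s := by
    rw [hs, sub_pos, div_lt_one (by linarith)]; linarith
  have hs1 : s < 1 := by linarith
  have hps : p * s = 1 := by rw [hp]; field_simp
  have hex : ∀ v, ∃ φ, LatNorm.Dual P φ ∧ ∑ j, φ j * (((A - Jm n) * h) v j) ^ 2 =
      P (fun j => (((A - Jm n) * h) v j) ^ 2) := fun v =>
    hP.exists_norming _ (fun j => sq_nonneg _)
  choose φ hφ hφx using hex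
  let S : Fin n → Fin n → ℝ := fun v w => (A v w + 1 / n) / 2
  have hS0 : ∀ v w, 0 ≤ S v w := fun v w => by
    have := hA0 v w; simp only [S]; positivity
  have hScol : ∀ w, ∑ v, S v w = 1 := by
    intro w
    simp only [S]
    rw [← sum_div, sum_add_distrib, sum_col_of_mem_doublyStochastic hA]
    simp; field_simp; norm_num
  have hTS : ∀ (g : Fin n → ℝ) v, (Matrix.mulVec (A - Jm n) g v) ^ 2 ≤ 4 * ∑ w, S v w * g w ^ 2 := by
    intro g v
    have e1 : Matrix.mulVec (A - Jm n) g v = ∑ w, A v w * g w - ∑ w, 1 / (n:ℝ) * g w := by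
      simp only [Matrix.mulVec, dotProduct, Matrix.sub_apply, Jm, Matrix.of_apply, sub_mul,
        sum_sub_distrib]
    have j1 := jensen (A v) g (hA0 v) (sum_row_of_mem_doublyStochastic hA v)
    have j2 := jensen (fun _ : Fin n => 1 / (n:ℝ)) g (fun _ => by positivity)
      (by simp; field_simp)
    have e2 : 4 * ∑ w, S v w * g w ^ 2 = 2 * ∑ w, A v w * g w ^ 2 + 2 * ∑ w, 1 / (n:ℝ) * g w ^ 2 := by
      simp only [mul_sum, ← sum_add_distrib, S]; apply sum_congr rfl; intro w _; ring
    rw [e1, e2]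
    nlinarith [sq_nonneg (∑ w, A v w * g w + ∑ w, 1 / (n:ℝ) * g w)]
  have hφ0 : ∀ v j, 0 ≤ φ v j := fun v j => (hφ v).1 j
  have hR0 : ∀ w j, 0 ≤ ∑ v, S v w * φ v j ^ p := fun w j =>
    sum_nonneg fun v _ => mul_nonneg (hS0 v w) (Real.rpow_nonneg (hφ0 v j) _)
  have hj : ∀ j, ∑ v, φ v j * (((A - Jm n) * h) v j) ^ 2 ≤
      D ^ (1 / (2 * q)) * ∑ w, 4 * ((∑ v, S v w * φ v j ^ p) ^ s * h w j ^ 2) := by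
    intro j
    have := interp (Matrix.mulVecLin (A - Jm n)) (fun w => 4 * ∑ v, S v w * φ v j ^ p)
      (fun v => φ v j ^ p) (fun w => mul_nonneg (by norm_num) (hR0 w j))
      (fun v => Real.rpow_nonneg (hφ0 v j) _) D hD s ⟨hs0, hs1⟩ (by
        intro g
        simp only [Matrix.mulVecLin_apply]
        calc _ ≤ ∑ v, φ v j ^ p * (4 * ∑ w, S v w * g w ^ 2) := by
              apply sum_le_sum; intro v _
              exact mul_le_mul_of_nonneg_left (hTS g v) (Real.rpow_nonneg (hφ0 v j) _)
          _ = _ := by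
              simp only [mul_sum, sum_mul]; rw [sum_comm]
              apply sum_congr rfl; intro v _; apply sum_congr rfl; intro w _; ring)
      (by intro g; simpa only [Matrix.mulVecLin_apply] using hAD g) (fun w => h w j)
    have e : ∀ v, ((A - Jm n) * h) v j = Matrix.mulVecLin (A - Jm n) (fun w => h w j) v := fun v => rfl
    have e1 : 1 - s = 1 / (2 * q) := by linarith
    simp only [e]
    rw [e1] at this
    calc _ = ∑ v, (φ v j ^ p) ^ s * (Matrix.mulVecLin (A - Jm n) (fun w => h w j) v) ^ 2 := by
          apply sum_congr rfl; intro v _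
          rw [← Real.rpow_mul (hφ0 v j), hps, Real.rpow_one]
      _ ≤ _ := this
      _ ≤ _ := by
          apply mul_le_mul_of_nonneg_left _ (Real.rpow_nonneg hD.le _)
          apply sum_le_sum; intro w _
          rw [Real.mul_rpow (by norm_num) (hR0 w j), mul_assoc]
          apply mul_le_mul_of_nonneg_right _
            (mul_nonneg (Real.rpow_nonneg (hR0 w j) _) (sq_nonneg _))
          calc (4:ℝ) ^ s ≤ 4 ^ (1:ℝ) := Real.rpow_le_rpow_of_exponent_le (by norm_num) hs1.le
            _ = 4 := Real.rpow_one _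
  unfold En
  calc _ = ∑ j, ∑ v, φ v j * (((A - Jm n) * h) v j) ^ 2 := by
        rw [sum_comm]; apply sum_congr rfl; intro v _; rw [hφx]
    _ ≤ ∑ j, D ^ (1 / (2 * q)) * ∑ w, 4 * ((∑ v, S v w * φ v j ^ p) ^ s * h w j ^ 2) :=
        sum_le_sum fun j _ => hj j
    _ = D ^ (1 / (2 * q)) * (4 * ∑ w, ∑ j, ((∑ v, S v w * φ v j ^ p) ^ s * h w j ^ 2)) := by
        rw [← mul_sum, sum_comm, mul_sum]; simp only [mul_sum]
    _ ≤ D ^ (1 / (2 * q)) * (4 * ∑ w, 9 * P (fun j => h w j ^ 2)) := by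
        apply mul_le_mul_of_nonneg_left _ (Real.rpow_nonneg hD.le _)
        apply mul_le_mul_of_nonneg_left _ (by norm_num)
        apply sum_le_sum; intro w _
        exact hP.psi_le hq (fun v => S v w) (fun v => hS0 v w) (hScol w) φ hφ s p hs hp _
          (fun j => sq_nonneg _)
    _ = _ := by rw [← mul_sum]; ring
end contr
end SG
namespace SG
section walk
variable {n d k : ℕ} {q : ℝ} {P : (Fin k → ℝ) → ℝ} (G : SimpleGraph (Fin n)) [DecidableRel G.Adj]

noncomputable def Mm (d : ℕ) : Matrix (Fin n) (Fin n) ℝ :=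
  (1 / 2 : ℝ) • (1 : Matrix (Fin n) (Fin n) ℝ) + (1 / (2 * (d:ℝ))) • Matrix.of (adj G)

lemma Mm_mem (hd : 3 ≤ d) (hreg : ∀ v, G.degree v = d) : Mm G d ∈ doublyStochastic ℝ (Fin n) := by
  have hdr : (0:ℝ) < d := by exact_mod_cast (by omega : 0 < d)
  rw [mem_doublyStochastic_iff_sum]
  have hrow : ∀ v, ∑ w, Mm G d v w = 1 := by
    intro v
    simp only [Mm, Matrix.add_apply, Matrix.smul_apply, Matrix.of_apply, smul_eq_mul,
      sum_add_distrib, ← mul_sum, adj_sum G hreg, Matrix.one_apply]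
    simp
    field_simp; norm_num
  have hsymm : ∀ v w, Mm G d v w = Mm G d w v := by
    intro v w
    simp only [Mm, Matrix.add_apply, Matrix.smul_apply, Matrix.of_apply, smul_eq_mul,
      Matrix.one_apply, adj_symm G v w, eq_comm]
  refine ⟨?_, hrow, ?_⟩
  · intro v w
    simp only [Mm, Matrix.add_apply, Matrix.smul_apply, Matrix.of_apply, smul_eq_mul,
      Matrix.one_apply]
    have := adj_nonneg G v w
    split_ifs <;> positivity
  · intro w; rw [← hrow w]; exact sum_congr rfl fun v _ => hsymm v w

lemma Mm_apply (g : Fin n → ℝ) (v : Fin n) :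
    Matrix.mulVec (Mm G d) g v = 1 / 2 * g v + 1 / (2 * (d:ℝ)) * ∑ w, adj G v w * g w := by
  simp only [Mm, Matrix.add_mulVec, Matrix.smul_mulVec, Matrix.one_mulVec, Pi.add_apply,
    Pi.smul_apply, smul_eq_mul]
  rfl

lemma Mm_contr (hd : 3 ≤ d) (hreg : ∀ v, G.degree v = d) {η : ℝ} (hη : 0 < η)
    (hcut : ∀ S : Finset (Fin n), 2 * S.card ≤ n → η * S.card ≤ (cutset G S).card)
    (g : Fin n → ℝ) (hg : ∑ v, g v = 0) :
    ∑ v, (Matrix.mulVec (Mm G d) g v) ^ 2 ≤ (1 - η ^ 2 / (16 * d ^ 2)) * ∑ v, g v ^ 2 := by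
  have hdr : (0:ℝ) < d := by exact_mod_cast (by omega : 0 < d)
  have hp := l2_poincare G hd hreg hη hcut g hg
  set Q := ∑ v, ∑ w, adj G v w * (g v - g w) ^ 2 with hQ
  have hsum1 : ∑ v, ∑ w, adj G v w * g v ^ 2 = d * ∑ v, g v ^ 2 := by
    simp only [← sum_mul, adj_sum G hreg]; rw [mul_sum]
  have hsum2 : ∑ v, ∑ w, adj G v w * g w ^ 2 = d * ∑ v, g v ^ 2 := by
    rw [sum_comm, ← hsum1]; apply sum_congr rfl; intro v _; apply sum_congr rfl; intro w _
    rw [adj_symm]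
  have h1 : ∑ v, (Matrix.mulVec (Mm G d) g v) ^ 2 ≤ ∑ v, g v ^ 2 - 1 / (4 * d) * Q := by
    calc _ ≤ ∑ v, ∑ w, (adj G v w / d) * ((g v + g w) / 2) ^ 2 := by
          apply sum_le_sum; intro v _
          have e : Matrix.mulVec (Mm G d) g v = ∑ w, (adj G v w / d) * ((g v + g w) / 2) := by
            rw [Mm_apply]
            have : ∀ w, (adj G v w / d) * ((g v + g w) / 2) =
              adj G v w * (g v / (2 * d)) + 1 / (2 * d) * (adj G v w * g w) := by intro w; field_simp
            simp only [this, sum_add_distrib, ← mul_sum, ← sum_mul, adj_sum G hreg]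
            field_simp
          rw [e]
          apply jensen
          · intro w; exact div_nonneg (adj_nonneg G v w) hdr.le
          · rw [← sum_div, adj_sum G hreg]; field_simp
      _ = 1 / (2 * d) * (∑ v, ∑ w, adj G v w * g v ^ 2 + ∑ v, ∑ w, adj G v w * g w ^ 2) -
            1 / (4 * d) * Q := by
          simp only [hQ, mul_sum, ← sum_add_distrib, ← sum_sub_distrib]
          apply sum_congr rfl; intro v _; apply sum_congr rfl; intro w _; field_simp; ring
      _ = _ := by rw [hsum1, hsum2]; field_simp; ring
  have h2 : η ^ 2 / (16 * d ^ 2) * ∑ v, g v ^ 2 ≤ 1 / (4 * d) * Q := by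
    calc _ ≤ η ^ 2 / (16 * d ^ 2) * (4 * d / η ^ 2 * Q) := by gcongr
      _ = _ := by field_simp; norm_num
  linarith

lemma pow_contr (hd : 3 ≤ d) (hreg : ∀ v, G.degree v = d) {κ : ℝ} (hκ : κ ≤ 1)
    (hc : ∀ g : Fin n → ℝ, ∑ v, g v = 0 →
      ∑ v, (Matrix.mulVec (Mm G d) g v) ^ 2 ≤ (1 - κ) * ∑ v, g v ^ 2)
    (m : ℕ) (g : Fin n → ℝ) (hg : ∑ v, g v = 0) :
    ∑ v, (Matrix.mulVec (Mm G d ^ m) g v) ^ 2 ≤ (1 - κ) ^ m * ∑ v, g v ^ 2 := by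
  induction m with
  | zero => simp
  | succ m ih =>
    rw [pow_succ', pow_succ', ← Matrix.mulVec_mulVec, mul_assoc]
    refine (hc _ ?_).trans (mul_le_mul_of_nonneg_left ih (by linarith))
    rw [sum_mulVec_of_mem_doublyStochastic (pow_mem (Mm_mem G hd hreg) m), hg]

lemma T_contr (hn : 0 < n) (hd : 3 ≤ d) (hreg : ∀ v, G.degree v = d) {κ : ℝ} (hκ : κ ≤ 1)
    (hc : ∀ g : Fin n → ℝ, ∑ v, g v = 0 →
      ∑ v, (Matrix.mulVec (Mm G d) g v) ^ 2 ≤ (1 - κ) * ∑ v, g v ^ 2)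
    (m : ℕ) (g : Fin n → ℝ) :
    ∑ v, (Matrix.mulVec (Mm G d ^ m - Jm n) g v) ^ 2 ≤ (1 - κ) ^ m * ∑ v, g v ^ 2 := by
  have hnr : (0:ℝ) < n := by exact_mod_cast hn
  set μ := (∑ v, g v) / n with hμ
  have hμ' : ∑ v, g v = n * μ := by rw [hμ]; field_simp
  set g0 : Fin n → ℝ := fun v => g v - μ with hg0
  have hs : ∑ v, g0 v = 0 := by simp [hg0, sum_sub_distrib, hμ']
  have e : ∀ v, Matrix.mulVec (Mm G d ^ m - Jm n) g v = Matrix.mulVec (Mm G d ^ m) g0 v := by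
    intro v
    have hr := sum_row_of_mem_doublyStochastic (pow_mem (Mm_mem G hd hreg) m) v
    simp only [Matrix.mulVec, dotProduct, Matrix.sub_apply, Jm, Matrix.of_apply, sub_mul, mul_sub,
        sum_sub_distrib, hg0, ← sum_mul, hr, ← mul_sum, hμ']
    field_simp
  simp only [e]
  refine (pow_contr G hd hreg hκ hc m g0 hs).trans ?_
  apply mul_le_mul_of_nonneg_left _ (pow_nonneg (by linarith) _)
  have : ∑ v, g0 v ^ 2 = ∑ v, g v ^ 2 - n * μ ^ 2 := by
    have e : ∀ v, g0 v ^ 2 = g v ^ 2 - 2 * μ * g v + μ ^ 2 := by intro v; simp only [hg0]; ring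
    simp only [e, sum_add_distrib, sum_sub_distrib, ← mul_sum, hμ']; simp; ring
  rw [this]
  have : 0 ≤ n * μ ^ 2 := by positivity
  linarith

lemma En_step (hP : LatNorm k q P) (hd : 3 ≤ d) (hreg : ∀ v, G.degree v = d)
    (h : Matrix (Fin n) (Fin k) ℝ) (B : ℝ)
    (hB : ∀ v w, G.Adj v w → P (fun j => (h v j - h w j) ^ 2) ≤ B) :
    En P ((1 - Mm G d) * h) ≤ n * (B / 4) := by
  have hdr : (0:ℝ) < d := by exact_mod_cast (by omega : 0 < d)
  unfold En
  have : ∀ v : Fin n, P (fun j => ((1 - Mm G d) * h : Matrix (Fin n) (Fin k) ℝ) v j ^ 2) ≤ B / 4 := by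
    intro v
    calc _ ≤ ∑ w, (adj G v w / d / 4) * P (fun j => (h v j - h w j) ^ 2) := by
          apply sum_smul_le hP _ _ _ _ (fun j => sq_nonneg _)
          · intro j
            have e : ((1 - Mm G d) * h : Matrix (Fin n) (Fin k) ℝ) v j = (∑ w, (adj G v w / d) * (h v j - h w j)) / 2 := by
              rw [Matrix.sub_mul, Matrix.one_mul, Matrix.sub_apply]
              have := Mm_apply (d := d) G (fun w => h w j) v
              have e2 : (Mm G d * h) v j = Matrix.mulVec (Mm G d) (fun w => h w j) v := rfl
              rw [e2, this]
              have : ∀ w, (adj G v w / d) * (h v j - h w j) =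
                adj G v w * (h v j / d) - 1 / d * (adj G v w * h w j) := by intro w; field_simp
              simp only [this, sum_sub_distrib, ← mul_sum, ← sum_mul, adj_sum G hreg]
              field_simp; ring
            rw [e, div_pow]
            have := jensen (fun w => adj G v w / d) (fun w => h v j - h w j)
              (fun w => div_nonneg (adj_nonneg G v w) hdr.le)
              (by rw [← sum_div, adj_sum G hreg]; field_simp)
            calc _ ≤ (∑ w, adj G v w / d * (h v j - h w j) ^ 2) / 2 ^ 2 := by gcongr
              _ = _ := by rw [sum_div]; apply sum_congr rfl; intro w _; ring
          · intro w; have := adj_nonneg G v w; positivity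
      _ ≤ ∑ w, (adj G v w / d / 4) * B := by
          apply sum_le_sum; intro w _
          by_cases hvw : G.Adj v w
          · exact mul_le_mul_of_nonneg_left (hB v w hvw) (by have := adj_nonneg G v w; positivity)
          · simp [adj, hvw]
      _ = _ := by rw [← sum_mul, ← sum_div, ← sum_div, adj_sum G hreg]; field_simp
  calc _ ≤ ∑ _v : Fin n, B / 4 := sum_le_sum fun v _ => this v
    _ = _ := by simp

lemma En_poinc (hP : LatNorm k q P) (hq : 2 ≤ q) (hn : 0 < n) (hd : 3 ≤ d)
    (hreg : ∀ v, G.degree v = d) {κ : ℝ} (hκ : κ < 1)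
    (hc : ∀ g : Fin n → ℝ, ∑ v, g v = 0 →
      ∑ v, (Matrix.mulVec (Mm G d) g v) ^ 2 ≤ (1 - κ) * ∑ v, g v ^ 2)
    (m : ℕ) (hm : 36 * ((1 - κ) ^ m) ^ (1 / (2 * q)) ≤ 1 / 8)
    (h : Matrix (Fin n) (Fin k) ℝ) (hh : ∀ j, ∑ v, h v j = 0) (B : ℝ)
    (hB : ∀ v w, G.Adj v w → P (fun j => (h v j - h w j) ^ 2) ≤ B) :
    En P h ≤ m ^ 2 * (n * B) := by
  have hM := Mm_mem G hd hreg
  have h1 := contr_main hP hq hn (Mm G d ^ m) (pow_mem hM m) ((1 - κ) ^ m)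
    (pow_pos (by linarith) _) (T_contr G hn hd hreg hκ.le hc m) h
  have hJ : Jm n * h = 0 := by
    ext v j; rw [Matrix.mul_apply]; simp only [Jm, Matrix.of_apply, ← mul_sum, hh]; simp
  have h2 : En P ((Mm G d ^ m - Jm n) * h) ≤ 1 / 8 * En P h :=
    h1.trans (mul_le_mul_of_nonneg_right hm (En_nonneg hP h))
  have h3 : En P ((1 - Mm G d ^ m) * h) ≤ m * (m * (n * (B / 4))) := by
    have e : (1 - Mm G d ^ m) * h = ∑ i ∈ range m, Mm G d ^ i * ((1 - Mm G d) * h) := by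
      rw [← Matrix.sum_mul, ← Matrix.mul_assoc, geom_sum_mul_neg]
    rw [e]
    refine (En_sum hP m _).trans ?_
    apply mul_le_mul_of_nonneg_left _ (by positivity)
    calc _ ≤ ∑ i ∈ range m, n * (B / 4) := by
          apply sum_le_sum; intro i _
          exact (En_stoch hP _ (pow_mem hM i) _).trans (En_step G hP hd hreg h B hB)
      _ = _ := by simp
  have h4 := En_add hP ((Mm G d ^ m - Jm n) * h) ((1 - Mm G d ^ m) * h)
  have e : (Mm G d ^ m - Jm n) * h + (1 - Mm G d ^ m) * h = h := by
    rw [Matrix.sub_mul, Matrix.sub_mul, hJ, Matrix.one_mul]; abel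
  rw [e] at h4
  have := En_nonneg hP h
  nlinarith
end walk
end SG
namespace SG
section final
variable {n d k : ℕ} {q : ℝ} {P : (Fin k → ℝ) → ℝ}

noncomputable def rt (x : ℝ) : ℝ := if 0 ≤ x then Real.sqrt x else - Real.sqrt (-x)

lemma rt_mul (x : ℝ) : rt x * |rt x| = x := by
  unfold rt; split_ifs with h
  · rw [abs_of_nonneg (Real.sqrt_nonneg _), Real.mul_self_sqrt h]
  · rw [abs_neg, abs_of_nonneg (Real.sqrt_nonneg _), neg_mul, Real.mul_self_sqrt (by linarith)]; ring

lemma rt_sq (x : ℝ) : rt x ^ 2 = |x| := by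
  conv_rhs => rw [← rt_mul x, abs_mul, abs_abs]
  rw [← sq, sq_abs]

lemma low (a b : ℝ) : (a - b) ^ 2 ≤ 2 * abs (a * |a| - b * |b|) := by
  rcases le_total 0 a with ha | ha <;> rcases le_total 0 b with hb | hb
  · rw [abs_of_nonneg ha, abs_of_nonneg hb]
    rcases le_total a b with h | h
    · rw [abs_of_nonpos (by nlinarith)]; nlinarith
    · rw [abs_of_nonneg (by nlinarith)]; nlinarith
  · rw [abs_of_nonneg ha, abs_of_nonpos hb]
    refine le_trans ?_ (mul_le_mul_of_nonneg_left (le_abs_self _) (by norm_num))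
    nlinarith [sq_nonneg (a + b)]
  · rw [abs_of_nonpos ha, abs_of_nonneg hb]
    refine le_trans ?_ (mul_le_mul_of_nonneg_left (neg_le_abs _) (by norm_num))
    nlinarith [sq_nonneg (a + b)]
  · rw [abs_of_nonpos ha, abs_of_nonpos hb]
    rcases le_total a b with h | h
    · rw [abs_of_nonpos (by nlinarith)]; nlinarith
    · rw [abs_of_nonneg (by nlinarith)]; nlinarith

lemma rt_low (x y : ℝ) : (rt x - rt y) ^ 2 ≤ 2 * |x - y| := by
  have := low (rt x) (rt y); rwa [rt_mul, rt_mul] at this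

lemma rt_up (x y : ℝ) : |x - y| ≤ 2 * (rt x - rt y) ^ 2 + (1/4 * |x| + 1/4 * |y|) := by
  have := sq_diff (rt x) (rt y)
  rw [rt_mul, rt_mul] at this
  refine this.trans ?_
  rw [← rt_sq x, ← rt_sq y, ← sq_abs (rt x - rt y), ← sq_abs (rt x), ← sq_abs (rt y)]
  nlinarith [sq_nonneg (4 * |rt x - rt y| - (|rt x| + |rt y|)), sq_nonneg (|rt x| - |rt y|)]

lemma mazur (G : SimpleGraph (Fin n)) [DecidableRel G.Adj]
    (hP : LatNorm k q P) (hq : 2 ≤ q) (hn : 0 < n) (hd : 3 ≤ d)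
    (hreg : ∀ v, G.degree v = d) {κ : ℝ} (hκ : κ < 1)
    (hc : ∀ g : Fin n → ℝ, ∑ v, g v = 0 →
      ∑ v, (Matrix.mulVec (Mm G d) g v) ^ 2 ≤ (1 - κ) * ∑ v, g v ^ 2)
    (m : ℕ) (hm : 36 * ((1 - κ) ^ m) ^ (1 / (2 * q)) ≤ 1 / 8)
    (f : Fin n → Fin k → ℝ) (R : ℝ) (hR : ∀ v w, G.Adj v w → P (f v - f w) ≤ R) :
    ∑ v, ∑ w, P (f v - f w) ≤ n ^ 2 * (32 * m ^ 2 * R) := by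
  have hnr : (0:ℝ) < n := by exact_mod_cast hn
  set DD := ∑ v, ∑ w, P (f v - f w) with hDD
  obtain ⟨w0, hw0⟩ : ∃ w0, n * ∑ v, P (f v - f w0) ≤ DD := by
    haveI : Nonempty (Fin n) := ⟨⟨0, hn⟩⟩
    obtain ⟨w0, _, h⟩ := exists_le_of_sum_le (s := (univ : Finset (Fin n)))
      (f := fun w => n * ∑ v, P (f v - f w)) (g := fun _ => DD) univ_nonempty (by
        rw [← mul_sum, sum_comm]; simp [hDD])
    exact ⟨w0, h⟩
  set F : Fin n → Fin k → ℝ := fun v => f v - f w0 with hF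
  have hFd : ∀ v w j, F v j - F w j = (f v - f w) j := by intro v w j; simp [hF]
  set g : Matrix (Fin n) (Fin k) ℝ := Matrix.of fun v j =>
    rt (F v j) - (∑ u, rt (F u j)) / n with hg
  have hgd : ∀ v w j, g v j - g w j = rt (F v j) - rt (F w j) := by intro v w j; simp [hg]
  have hE := En_poinc G hP hq hn hd hreg hκ hc m hm g (by
    intro j; simp only [hg, Matrix.of_apply, sum_sub_distrib]; simp; field_simp; simp) (2 * R) (by
    intro v w hvw
    have h2 : P ((2:ℝ) • (f v - f w)) ≤ 2 * R := by
      rw [hP.smul_of_nonneg (by norm_num)]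
      have := hR v w hvw; linarith
    refine le_trans (hP.mono _ _ fun j => ?_) h2
    rw [hgd, abs_of_nonneg (sq_nonneg _), Pi.smul_apply, smul_eq_mul, abs_mul, ← hFd, abs_two]
    exact rt_low _ _)
  have hup : ∀ v w, P (f v - f w) ≤ 2 * P (fun j => (g v j - g w j) ^ 2) +
      (1/4 * P (F v) + 1/4 * P (F w)) := by
    intro v w
    have habs : ∀ x : Fin k → ℝ, P (fun j => |x j|) ≤ P x := fun x =>
      hP.mono _ _ fun j => by rw [abs_abs]
    calc P (f v - f w) ≤ P ((2:ℝ) • (fun j => (g v j - g w j) ^ 2) +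
          ((1/4:ℝ) • (fun j => |F v j|) + (1/4:ℝ) • (fun j => |F w j|))) := by
          apply hP.mono; intro j
          refine le_trans ?_ (le_abs_self _)
          simp only [Pi.add_apply, Pi.smul_apply, smul_eq_mul, hgd]
          have := rt_up (F v j) (F w j)
          rwa [hFd] at this
      _ ≤ P ((2:ℝ) • (fun j => (g v j - g w j) ^ 2)) +
          (P ((1/4:ℝ) • (fun j => |F v j|)) + P ((1/4:ℝ) • (fun j => |F w j|))) :=
          (hP.add _ _).trans (add_le_add le_rfl (hP.add _ _))
      _ ≤ _ := by
          rw [hP.smul_of_nonneg (by norm_num), hP.smul_of_nonneg (by norm_num),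
            hP.smul_of_nonneg (by norm_num)]
          have := habs (F v); have := habs (F w)
          linarith
  have hgg : ∀ v w, P (fun j => (g v j - g w j) ^ 2) ≤
      2 * P (fun j => g v j ^ 2) + 2 * P (fun j => g w j ^ 2) := by
    intro v w
    have := sq_add_le hP (g v) (fun j => - g w j) (fun j => g v j - g w j) (fun j => by ring)
    simpa using this
  have htot : DD ≤ ∑ v : Fin n, ∑ w : Fin n, (2 * (2 * P (fun j => g v j ^ 2) +
      2 * P (fun j => g w j ^ 2)) + (1/4 * P (F v) + 1/4 * P (F w))) := by
    apply sum_le_sum; intro v _; apply sum_le_sum; intro w _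
    have := hup v w; have := hgg v w; linarith
  have hev : ∑ v : Fin n, ∑ w : Fin n, (2 * (2 * P (fun j => g v j ^ 2) +
      2 * P (fun j => g w j ^ 2)) + (1/4 * P (F v) + 1/4 * P (F w))) =
      8 * (n * En P g) + 1 / 2 * (n * ∑ v, P (F v)) := by
    simp only [sum_add_distrib, ← mul_sum, En]
    simp only [sum_const, card_univ, Fintype.card_fin, nsmul_eq_mul, ← mul_sum]
    ring
  rw [hev] at htot
  have h1 : n * En P g ≤ n * (m ^ 2 * (n * (2 * R))) := by gcongr
  nlinarith
end final
end SG
/-- Corollary 1.8 (inner estimate): a low-distortion embedding of a graph with the long-range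
expansion property forces the average distance to be at most `20 Γ`. -/
theorem stmt_3 {n d k : ℕ} (q C K α ε L : ℝ)
    (hq : 2 ≤ q) (hC : 1 ≤ C) (hK : 1 ≤ K) (hd : 3 ≤ d)
    (hα : 0 < α ∧ α ≤ 1) (hε : 0 < ε ∧ ε ≤ 1) (hL : 1 ≤ L)
    (G : SimpleGraph (Fin n)) [DecidableRel G.Adj]
    (hreg : ∀ v, G.degree v = d)
    (hExp : Expan n d G α ε L)
    (N : (Fin k → ℝ) → ℝ)
    (hN : IsNorm k N) (hunc : UncondConst k N K) (hcot : HasCotype k N q C)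
    (f : Fin n → Fin k → ℝ)
    (hf : ∀ v w, (G.dist v w : ℝ) ≤ N (f v - f w) ∧ N (f v - f w) ≤ 20 * (G.dist v w : ℝ)) :
    1 / (n : ℝ) ^ 2 * ∑ v, ∑ w, (G.dist v w : ℝ) ≤
      20 * (2 ^ 115 * q ^ 10 * C ^ 2 * K ^ 3 * ((d : ℝ) ^ 25 * L ^ 8 / (α ^ 14 * ε ^ 18))) := by
  rcases Nat.eq_zero_or_pos n with rfl | hn
  · have hα0 := hα.1
    have hε0 := hε.1
    simp
    positivity
  have hα0 := hα.1
  have hα1 := hα.2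
  have hε0 := hε.1
  have hε1 := hε.2
  have hnr : (0:ℝ) < n := by exact_mod_cast hn
  have hdr : (3:ℝ) ≤ d := by exact_mod_cast hd
  have hd0 : (0:ℝ) < d := by linarith
  obtain ⟨P, hP, hNP⟩ := SG.renorm (hq := hq) (hC := hC) (hK := hK) (hN := hN) (hunc := hunc)
    (hcot := hcot)
  have hη : 0 < α ^ 2 / (8 * (d:ℝ) ^ 2) := by positivity
  have hc := SG.Mm_contr G hd hreg hη (SG.cut_bound G hd hreg hα hExp.1)
  set κ : ℝ := (α ^ 2 / (8 * (d:ℝ) ^ 2)) ^ 2 / (16 * d ^ 2) with hκ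
  have hκe : κ = α ^ 4 / (2 ^ 10 * d ^ 6) := by rw [hκ]; field_simp; norm_num
  have hκ0 : 0 < κ := by positivity
  have hd6 : (1:ℝ) ≤ d ^ 6 := one_le_pow₀ (by linarith)
  have hα4 : α ^ 4 ≤ 1 := pow_le_one₀ hα0.le hα1
  have hκ1 : κ < 1 := by
    rw [hκe, div_lt_one (by positivity)]; nlinarith
  set m : ℕ := ⌈12 * q / κ⌉₊ with hm
  have hm1 : 12 * q / κ ≤ m := Nat.le_ceil _
  have hm2 : (m:ℝ) ≤ 16 * q / κ := by
    have h1 : (m:ℝ) < 12 * q / κ + 1 := Nat.ceil_lt_add_one (by positivity)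
    have h2 : 1 ≤ 4 * q / κ := by rw [le_div_iff₀ hκ0]; linarith
    have h3 : 16 * q / κ = 12 * q / κ + 4 * q / κ := by ring
    linarith
  have hmm : 36 * ((1 - κ) ^ m) ^ (1 / (2 * q)) ≤ 1 / 8 := by
    have h1 : (1 - κ) ^ m ≤ Real.exp (-(12 * q)) := by
      calc (1 - κ) ^ m ≤ (Real.exp (-κ)) ^ m :=
            pow_le_pow_left₀ (by linarith) (Real.one_sub_le_exp_neg κ) _
        _ = Real.exp (-(m * κ)) := by rw [← Real.exp_nat_mul]; ring_nf
        _ ≤ _ := by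
            apply Real.exp_le_exp.2
            rw [div_le_iff₀ hκ0] at hm1
            linarith
    have h2 : ((1 - κ) ^ m) ^ (1 / (2 * q)) ≤ Real.exp (-6) := by
      calc _ ≤ (Real.exp (-(12 * q))) ^ (1 / (2 * q)) :=
            Real.rpow_le_rpow (pow_nonneg (by linarith) _) h1 (by positivity)
        _ = _ := by rw [← Real.exp_mul]; congr 1; field_simp; norm_num
    have h3 : (288:ℝ) ≤ Real.exp 6 := by
      have : Real.exp 6 = Real.exp 1 ^ 6 := by rw [← Real.exp_nat_mul]; norm_num
      rw [this]
      have h := Real.exp_one_gt_d9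
      calc (288:ℝ) ≤ 2.7 ^ 6 := by norm_num
        _ ≤ _ := pow_le_pow_left₀ (by norm_num) (by linarith) _
    have h4 : Real.exp (-6) ≤ 1 / 288 := by
      rw [Real.exp_neg, ← one_div]; exact one_div_le_one_div_of_le (by norm_num) h3
    linarith
  have hfin := SG.mazur G hP hq hn hd hreg hκ1 hc m hmm f (20 * (C * K)) (by
    intro v w hvw
    have h1 := (hf v w).2
    rw [SimpleGraph.dist_eq_one_iff_adj.2 hvw] at h1
    have h2 := (hNP (f v - f w)).2
    refine h2.trans ?_
    rw [mul_comm]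
    apply mul_le_mul_of_nonneg_right _ (by positivity)
    simpa using h1)
  have h1 : ∑ v, ∑ w, (G.dist v w : ℝ) ≤ n ^ 2 * (32 * m ^ 2 * (20 * (C * K))) :=
    le_trans (sum_le_sum fun v _ => sum_le_sum fun w _ => (hf v w).1.trans (hNP _).1) hfin
  have h2 : 1 / (n : ℝ) ^ 2 * ∑ v, ∑ w, (G.dist v w : ℝ) ≤ 32 * m ^ 2 * (20 * (C * K)) := by
    rw [div_mul_eq_mul_div, one_mul, div_le_iff₀ (by positivity), mul_comm]; exact h1
  refine h2.trans ?_
  have h3 : (m:ℝ) ≤ 2 ^ 14 * (q * (d ^ 6 / α ^ 4)) := by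
    refine hm2.trans (le_of_eq ?_)
    rw [hκe]; field_simp; norm_num
  have h4 : (m:ℝ) ^ 2 ≤ 2 ^ 28 * (q ^ 2 * (d ^ 12 / α ^ 8)) := by
    calc (m:ℝ) ^ 2 ≤ (2 ^ 14 * (q * (d ^ 6 / α ^ 4))) ^ 2 := pow_le_pow_left₀ (by positivity) h3 _
      _ = _ := by ring
  have h5 : (d:ℝ) ^ 12 / α ^ 8 ≤ (d : ℝ) ^ 25 * L ^ 8 / (α ^ 14 * ε ^ 18) := by
    apply div_le_div₀ (by positivity) _ (by positivity) _
    · calc (d:ℝ) ^ 12 ≤ d ^ 25 * 1 := by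
            rw [mul_one]; exact pow_le_pow_right₀ (by linarith) (by norm_num)
        _ ≤ _ := by gcongr; exact one_le_pow₀ hL
    · calc α ^ 14 * ε ^ 18 ≤ α ^ 8 * 1 :=
            mul_le_mul (pow_le_pow_of_le_one hα0.le hα1 (by norm_num))
              (pow_le_one₀ hε0.le hε1) (by positivity) (by positivity)
        _ = _ := mul_one _
  have h6 : q ^ 2 ≤ q ^ 10 := pow_le_pow_right₀ (by linarith) (by norm_num)
  have h7 : C ≤ C ^ 2 := le_self_pow₀ hC (by norm_num)
  have h8 : K ≤ K ^ 3 := le_self_pow₀ hK (by norm_num)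
  calc 32 * (m:ℝ) ^ 2 * (20 * (C * K))
      ≤ 32 * (2 ^ 28 * (q ^ 10 * ((d : ℝ) ^ 25 * L ^ 8 / (α ^ 14 * ε ^ 18)))) *
        (20 * (C ^ 2 * K ^ 3)) := by
        have h9 : (m:ℝ) ^ 2 ≤ 2 ^ 28 * (q ^ 10 * ((d : ℝ) ^ 25 * L ^ 8 / (α ^ 14 * ε ^ 18))) := by
          refine h4.trans ?_
          gcongr
        gcongr
    _ = 20 * (2 ^ 33 * (q ^ 10 * C ^ 2 * K ^ 3 * ((d : ℝ) ^ 25 * L ^ 8 / (α ^ 14 * ε ^ 18)))) := by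
        ring
    _ ≤ 20 * (2 ^ 115 * (q ^ 10 * C ^ 2 * K ^ 3 * ((d : ℝ) ^ 25 * L ^ 8 / (α ^ 14 * ε ^ 18)))) := by
        gcongr
        · norm_num
        · norm_num
    _ = _ := by ring
end
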